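/- arXiv:math/0612582 — 2 statements merged into one kernel-verified Lean document; each statement's English description precedes it below -/
import Mathlib

section
/- Let F = x₀f_{d-1} + f_d define a normalized non-degenerate monoid surface in ℙ³, and let b ∈ ℙ² be a common zero of f_{d-1} and f_d. The line L_b contains a singular point of Z(F) other than O = (1:0:0:0) if and only if Z(f_{d-1}) is nonsingular at b and the intersection multiplicity I_b(f_{d-1}, f_d) > 1. -/
open MvPolynomial

variable {K : Type*} [Field K]

def SingularAt {R : Type*} [CommRing R] {n : ℕ} (F : MvPolynomial (Fin (n + 1)) R)
    (P : Fin (n + 1) → R) : Prop :=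
  eval P F = 0 ∧ ∀ i, eval P (pderiv i F) = 0

noncomputable def lineEval (p : Fin 3 → K) :
    MvPolynomial (Fin 3) K →ₐ[K] Polynomial K :=
  aeval fun i => Polynomial.C (p i) * Polynomial.X

noncomputable def lineCompl (p : Fin 3 → K) : Submonoid (MvPolynomial (Fin 3) K) where
  carrier := {h | lineEval p h ≠ 0}
  one_mem' := by simp [lineEval]
  mul_mem' := by
    intro a b ha hb
    simp only [Set.mem_setOf_eq, map_mul] at *
    exact mul_ne_zero ha hb

/-- The local intersection number `I_p(f,g)` of two plane curves. -/
noncomputable def interMult (f g : MvPolynomial (Fin 3) K) (p : Fin 3 → K) : WithBot ℕ∞ :=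
  Order.krullDim (Ideal (Localization (lineCompl p) ⧸
    (Ideal.span {algebraMap (MvPolynomial (Fin 3) K) (Localization (lineCompl p)) f,
      algebraMap (MvPolynomial (Fin 3) K) (Localization (lineCompl p)) g})))

theorem homEval {S : Type*} [CommRing S] [Algebra K S] {n : ℕ} (b : Fin 3 → K) (s : S)
    (p : MvPolynomial (Fin 3) K) (hp : p.IsHomogeneous n) :
    aeval (fun j => algebraMap K S (b j) * s) p = algebraMap K S (eval b p) * s ^ n := by
  rw [aeval_def, eval₂_eq', eval_eq', map_sum, Finset.sum_mul]
  refine Finset.sum_congr rfl fun e he => ?_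
  have h1 : ∑ i, e i = n := by
    have := hp (mem_support_iff.mp he)
    rw [Finsupp.weight_apply, Finsupp.sum_fintype _ _ (by simp)] at this
    simpa using this
  simp only [mul_pow, Finset.prod_mul_distrib, Finset.prod_pow_eq_pow_sum, h1, map_mul, map_prod,
    map_pow]
  ring

theorem taylorTwo (I : Ideal (MvPolynomial (Fin 3) K)) (c : Fin 3 → MvPolynomial (Fin 3) K)
    (hc : ∀ j, X j - c j ∈ I) (p : MvPolynomial (Fin 3) K) :
    p - aeval c p - ∑ j, (X j - c j) * aeval c (pderiv j p) ∈ I ^ 2 := by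
  induction p using MvPolynomial.induction_on with
  | C a => simp [MvPolynomial.algebraMap_eq]
  | add p q hp hq =>
    have := add_mem hp hq
    convert this using 1
    simp only [map_add, mul_add, Finset.sum_add_distrib]
    ring
  | mul_X p k hp =>
    set D := ∑ j, (X j - c j) * aeval c (pderiv j p) with hD
    have hDI : D ∈ I := Ideal.sum_mem _ fun j _ => Ideal.mul_mem_right _ _ (hc j)
    have h1 : ∑ j, (X j - c j) * aeval c (pderiv j (p * X k))
        = D * c k + (X k - c k) * aeval c p := by
      have h : ∀ j, (X j - c j) * aeval c (pderiv j (p * X k)) =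
          (X j - c j) * aeval c (pderiv j p) * c k +
            (if j = k then (X k - c k) * aeval c p else 0) := by
        intro j
        rw [pderiv_mul, map_add, map_mul, map_mul, aeval_X]
        split_ifs with hj
        · subst hj
          rw [pderiv_X_self, map_one]; ring
        · rw [pderiv_X_of_ne (Ne.symm hj), map_zero]; ring
      rw [Finset.sum_congr rfl fun j _ => h j, Finset.sum_add_distrib, ← Finset.sum_mul, ← hD,
        Finset.sum_ite_eq' Finset.univ k, if_pos (Finset.mem_univ k)]
    have h2 : D * (X k - c k) ∈ I ^ 2 := by
      rw [pow_two]; exact Ideal.mul_mem_mul hDI (hc k)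
    have := add_mem (Ideal.mul_mem_right (X k) _ hp) h2
    have h3 : p * X k - aeval c (p * X k) - (D * c k + (X k - c k) * aeval c p) =
        (p - aeval c p - D) * X k + D * (X k - c k) := by
      rw [map_mul, aeval_X]
      ring
    rw [h1, h3]
    exact this

theorem lengthLe {A : Type*} [CommRing A] [IsLocalRing A] (J : Ideal A)
    (hJ : J ≤ IsLocalRing.maximalIdeal A) :
    Order.krullDim (Ideal (A ⧸ J)) ≤ 1 ↔ J = IsLocalRing.maximalIdeal A := by
  rw [Order.krullDim_le_one_iff_of_boundedOrder]
  constructor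
  · intro h
    rcases h ((IsLocalRing.maximalIdeal A).map (Ideal.Quotient.mk J)) with h | h
    · rw [Ideal.map_eq_bot_iff_le_ker, Ideal.mk_ker] at h
      exact le_antisymm hJ h
    · exfalso
      have := congrArg (Ideal.comap (Ideal.Quotient.mk J)) h
      rw [Ideal.comap_map_of_surjective _ Ideal.Quotient.mk_surjective, Ideal.comap_top,
        ← RingHom.ker_eq_comap_bot, Ideal.mk_ker, sup_eq_left.mpr hJ] at this
      exact (IsLocalRing.maximalIdeal.isMaximal A).ne_top this
  · rintro h
    have hm : J.IsMaximal := h ▸ IsLocalRing.maximalIdeal.isMaximal A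
    letI := Ideal.Quotient.field J
    intro x
    exact eq_bot_or_eq_top x

theorem lineEval_eval (b : Fin 3 → K) (t : K) (p : MvPolynomial (Fin 3) K) :
    (lineEval b p).eval t = eval (fun j => b j * t) p := by
  have : ((Polynomial.aeval t).comp (lineEval b)) = aeval (fun j => b j * t) := by
    apply MvPolynomial.algHom_ext
    intro i
    simp [lineEval]
  have h := congrArg (fun q => q p) this
  simpa [Polynomial.coe_aeval_eq_eval, aeval_eq_eval] using h

theorem euler (b : Fin 3 → K) {n : ℕ} (p : MvPolynomial (Fin 3) K) (hp : p.IsHomogeneous n)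
    (h0 : eval b p = 0) : ∑ j, b j * eval b (pderiv j p) = 0 := by
  have := congrArg (eval b) hp.sum_X_mul_pderiv
  simpa [h0] using this

theorem evalScale (b : Fin 3 → K) (t : K) {n : ℕ} (p : MvPolynomial (Fin 3) K)
    (hp : p.IsHomogeneous n) : eval (fun j => b j * t) p = eval b p * t ^ n := by
  simpa [aeval_eq_eval] using homEval (S := K) b t p hp

theorem singIff {d : ℕ} (hd : 3 ≤ d)
    (f g : MvPolynomial (Fin 3) K)
    (hf : f.IsHomogeneous (d - 1)) (hg : g.IsHomogeneous d) 
    (b : Fin 3 → K) (hbf : eval b f = 0) (hbg : eval b g = 0) :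
    (∃ s t : K, t ≠ 0 ∧
        SingularAt (X 0 * rename Fin.succ f + rename Fin.succ g)
          (Fin.cons s fun j => t * b j)) ↔
      ∃ c : K, ∀ j, eval b (pderiv j g) = c * eval b (pderiv j f) := by
  have key : ∀ s t : K, t ≠ 0 → (SingularAt (X 0 * rename Fin.succ f + rename Fin.succ g)
          (Fin.cons s fun j => t * b j) ↔
        ∀ j, s * eval b (pderiv j f) + t * eval b (pderiv j g) = 0) := by
    intro s t ht
    have hcomp : (Fin.cons s (fun j => t * b j) : Fin 4 → K) ∘ Fin.succ = fun j => b j * t := by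
      funext j; simp [mul_comm]
    have h0 : ∀ p : MvPolynomial (Fin 3) K,
        pderiv (0 : Fin 4) (rename Fin.succ p) = 0 := by
      intro p
      classical
      apply pderiv_eq_zero_of_notMem_vars
      intro h
      have := vars_rename Fin.succ p h
      simp at this
      
    unfold SingularAt
    rw [Fin.forall_fin_succ]
    simp only [map_add, map_mul, eval_X, eval_rename, hcomp, pderiv_mul, h0, pderiv_X_self,
      pderiv_rename (Fin.succ_injective 3), Fin.cons_zero, evalScale b t f hf, evalScale b t g hg,
      hbf, hbg, evalScale b t _ hf.pderiv, evalScale b t _ hg.pderiv]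
    have hX : ∀ j : Fin 3, pderiv j.succ (X 0 : MvPolynomial (Fin 4) K) = 0 := fun j =>
      pderiv_X_of_ne (Fin.succ_ne_zero j).symm
    simp only [hX, map_zero, map_one, zero_mul, mul_zero, add_zero, true_and, zero_add]
    obtain ⟨e, rfl⟩ : ∃ e, d = e + 2 := ⟨d - 2, by omega⟩
    refine forall_congr' fun j => ?_
    have : s * (eval b (pderiv j f) * t ^ (e + 2 - 1 - 1)) + eval b (pderiv j g) * t ^ (e + 2 - 1)
        = t ^ e * (s * eval b (pderiv j f) + t * eval b (pderiv j g)) := by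
      have e1 : e + 2 - 1 - 1 = e := by omega
      have e2 : e + 2 - 1 = e + 1 := by omega
      rw [e1, e2]; ring
    rw [this]
    simp [ht]
  constructor
  · rintro ⟨s, t, ht, h⟩
    rw [key s t ht] at h
    refine ⟨-s / t, fun j => ?_⟩
    have := h j
    field_simp
    linear_combination this
  · rintro ⟨c, h⟩
    refine ⟨-c, 1, one_ne_zero, ?_⟩
    rw [key _ _ one_ne_zero]
    intro j
    rw [h j]; ring

theorem localPart [Infinite K] {n m : ℕ}
    (f g : MvPolynomial (Fin 3) K)
    (hf : f.IsHomogeneous n) (hg : g.IsHomogeneous m)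
    (b : Fin 3 → K) (hb : b ≠ 0) (hbf : eval b f = 0) (hbg : eval b g = 0)
    (hfs : ∃ j, eval b (pderiv j f) ≠ 0) :
    (1 : WithBot ℕ∞) < interMult f g b ↔
      ∃ c : K, ∀ j, eval b (pderiv j g) = c * eval b (pderiv j f) := by
  obtain ⟨i, hi⟩ : ∃ i, b i ≠ 0 := Function.ne_iff.mp hb
  set P : Ideal (MvPolynomial (Fin 3) K) := RingHom.ker (lineEval b) with hP
  have hPmem : ∀ p, p ∈ P ↔ lineEval b p = 0 := fun p => RingHom.mem_ker
  have hPprime : P.IsPrime := RingHom.ker_isPrime _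
  have hcompl : lineCompl b = P.primeCompl := by
    ext p
    rfl
  haveI hloc : IsLocalization.AtPrime (Localization (lineCompl b)) P := by
    unfold IsLocalization.AtPrime
    rw [← hcompl]
    infer_instance
  set A := Localization (lineCompl b)
  haveI : IsLocalRing A := IsLocalization.AtPrime.isLocalRing A P
  haveI : IsNoetherianRing A := IsLocalization.isNoetherianRing (lineCompl b) A inferInstance
  set φ := algebraMap (MvPolynomial (Fin 3) K) A with hφ
  have hmap : P.map φ = IsLocalRing.maximalIdeal A := IsLocalization.AtPrime.map_eq_maximalIdeal P A
  have hhom : ∀ {n : ℕ} (p : MvPolynomial (Fin 3) K), p.IsHomogeneous n → eval b p = 0 → p ∈ P := by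
    intro n p hp h0
    rw [hPmem]
    have := homEval (S := Polynomial K) b Polynomial.X p hp
    rw [h0, map_zero, zero_mul] at this
    exact this
  have hJ : Ideal.span {φ f, φ g} ≤ IsLocalRing.maximalIdeal A := by
    rw [← hmap, Ideal.span_le]
    rintro x (rfl | rfl)
    · exact Ideal.mem_map_of_mem _ (hhom f hf hbf)
    · exact Ideal.mem_map_of_mem _ (hhom g hg hbg)
  have hint : (1 : WithBot ℕ∞) < interMult f g b ↔
      Ideal.span {φ f, φ g} ≠ IsLocalRing.maximalIdeal A := by
    rw [← not_le, Ne, ← lengthLe _ hJ]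
    rfl
  rw [hint]
  obtain ⟨j, k, hij, hik, hjk, hsum⟩ : ∃ j k : Fin 3, i ≠ j ∧ i ≠ k ∧ j ≠ k ∧
      (∀ P : Fin 3 → Prop, P i → P j → P k → ∀ l, P l) := by
    have : ∀ i : Fin 3, ∃ j k : Fin 3, i ≠ j ∧ i ≠ k ∧ j ≠ k ∧ ∀ l, l = i ∨ l = j ∨ l = k := by
      decide
    obtain ⟨j, k, h1, h2, h3, h4⟩ := this i
    refine ⟨j, k, h1, h2, h3, fun P hi hj hk l => ?_⟩
    rcases h4 l with rfl | rfl | rfl <;> assumption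
  have hsum3 : ∀ {S : Type _} [AddCommMonoid S] (u : Fin 3 → S), ∑ l, u l = u i + u j + u k := by
    intro S _ u
    have : (Finset.univ : Finset (Fin 3)) = {i, j, k} := by
      ext l
      simp only [Finset.mem_univ, Finset.mem_insert, Finset.mem_singleton, true_iff]
      exact hsum (fun l => l = i ∨ l = j ∨ l = k) (by simp) (by simp) (by simp) l
    rw [this, Finset.sum_insert (by simp [hij, hik]), Finset.sum_insert (by simp [hjk]),
      Finset.sum_singleton, add_assoc]
  have ef := euler b f hf hbf
  have eg := euler b g hg hbg
  rw [hsum3] at ef eg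
  constructor
  · intro hne
    by_contra hcon
    apply hne
    apply le_antisymm hJ
    set s : MvPolynomial (Fin 3) K := C (b i)⁻¹ * X i with hs
    set c : Fin 3 → MvPolynomial (Fin 3) K := fun l => C (b l) * s with hc
    have hyP : ∀ l, X l - c l ∈ P := by
      intro l
      rw [hPmem]
      simp only [hc, hs, lineEval, map_sub, map_mul, aeval_X, algHom_C, Polynomial.algebraMap_eq]
      have : Polynomial.C (b i)⁻¹ * Polynomial.C (b i) = 1 := by
        rw [← Polynomial.C_mul, inv_mul_cancel₀ hi, Polynomial.C_1]
      linear_combination (-Polynomial.C (b l) * Polynomial.X) * this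
    have hyi : X i - c i = 0 := by
      have : (C (b i)⁻¹ * C (b i) : MvPolynomial (Fin 3) K) = 1 := by
        rw [← C_mul, inv_mul_cancel₀ hi, C_1]
      simp only [hc, hs]
      linear_combination (-X i) * this
    have hPspan : P ≤ Ideal.span (Set.range fun l => X l - c l) := by
      intro p hp
      have h1 := taylorTwo (Ideal.span (Set.range fun l => X l - c l)) c
        (fun l => Ideal.subset_span ⟨l, rfl⟩) p
      have h2 : aeval c p = 0 := by
        have : (Polynomial.aeval s).comp (lineEval b) = aeval c := by
          apply MvPolynomial.algHom_ext
          intro l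
          simp [lineEval, hc, MvPolynomial.algebraMap_eq]
        rw [← this, AlgHom.comp_apply, (hPmem p).mp hp, map_zero]
      rw [h2, sub_zero] at h1
      have h3 := Ideal.pow_le_self two_ne_zero h1
      have h4 : ∑ l, (X l - c l) * aeval c (pderiv l p) ∈
          Ideal.span (Set.range fun l => X l - c l) :=
        Ideal.sum_mem _ fun l _ => Ideal.mul_mem_right _ _ (Ideal.subset_span ⟨l, rfl⟩)
      simpa using add_mem h3 h4
    set m' := IsLocalRing.maximalIdeal A
    have hsu : IsUnit (φ s) := by
      have : s ∈ P.primeCompl := by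
        show ¬ s ∈ P
        rw [hPmem]
        simp [hs, lineEval, hi, Polynomial.algebraMap_eq]
      exact IsLocalization.map_units A (⟨s, this⟩ : P.primeCompl)
    set J := Ideal.span {φ f, φ g} with hJdef
    set T := J ⊔ m' • m' with hT
    have hell : ∀ {n : ℕ} (p : MvPolynomial (Fin 3) K), p.IsHomogeneous n → eval b p = 0 →
        φ p ∈ J →
        φ (C (eval b (pderiv j p)) * (X j - c j) + C (eval b (pderiv k p)) * (X k - c k)) ∈ T := by
      intro n p hp h0 hpJ
      have h1 := taylorTwo P c hyP p
      have hz : aeval c p = 0 := by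
        have := homEval (S := MvPolynomial (Fin 3) K) b s p hp
        rw [h0, map_zero, zero_mul] at this
        exact this
      have hd : ∀ l, aeval c (pderiv l p) = C (eval b (pderiv l p)) * s ^ (n - 1) := fun l =>
        homEval (S := MvPolynomial (Fin 3) K) b s _ hp.pderiv
      rw [hz, hsum3, hyi] at h1
      simp only [hd] at h1
      have h2 := Ideal.mem_map_of_mem φ h1
      rw [Ideal.map_pow, hmap, pow_two] at h2
      have h3 : φ p - φ (p - 0 - (0 * (C (eval b (pderiv i p)) * s ^ (n - 1)) +
          (X j - c j) * (C (eval b (pderiv j p)) * s ^ (n - 1)) +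
          (X k - c k) * (C (eval b (pderiv k p)) * s ^ (n - 1)))) ∈ T :=
        sub_mem (Ideal.mem_sup_left hpJ) (Ideal.mem_sup_right h2)
      rw [← map_sub] at h3
      have h4 : p - (p - 0 - (0 * (C (eval b (pderiv i p)) * s ^ (n - 1)) +
          (X j - c j) * (C (eval b (pderiv j p)) * s ^ (n - 1)) +
          (X k - c k) * (C (eval b (pderiv k p)) * s ^ (n - 1)))) =
          s ^ (n - 1) * (C (eval b (pderiv j p)) * (X j - c j) +
            C (eval b (pderiv k p)) * (X k - c k)) := by ring
      rw [h4, map_mul, map_pow] at h3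
      exact (Ideal.unit_mul_mem_iff_mem _ (hsu.pow _)).mp h3
    have hlf := hell f hf hbf (Ideal.subset_span (by simp))
    have hlg := hell g hg hbg (Ideal.subset_span (by simp))
    have hdet : eval b (pderiv j f) * eval b (pderiv k g) -
        eval b (pderiv k f) * eval b (pderiv j g) ≠ 0 := by
      intro hdet
      apply hcon
      have hfi : eval b (pderiv i f) =
          -(b j * eval b (pderiv j f) + b k * eval b (pderiv k f)) / b i := by
        field_simp; linear_combination ef
      have hgi : eval b (pderiv i g) =
          -(b j * eval b (pderiv j g) + b k * eval b (pderiv k g)) / b i := by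
        field_simp; linear_combination eg
      by_cases h1 : eval b (pderiv j f) = 0
      · by_cases h2 : eval b (pderiv k f) = 0
        · exfalso
          obtain ⟨l, hl⟩ := hfs
          exact hl (hsum (fun l => eval b (pderiv l f) = 0) (by rw [hfi, h1, h2]; simp) h1 h2 l)
        · refine ⟨eval b (pderiv k g) / eval b (pderiv k f), ?_⟩
          have hj : eval b (pderiv j g) =
              eval b (pderiv k g) / eval b (pderiv k f) * eval b (pderiv j f) := by
            field_simp; linear_combination -hdet
          have hk : eval b (pderiv k g) =
              eval b (pderiv k g) / eval b (pderiv k f) * eval b (pderiv k f) := by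
            field_simp
          refine hsum _ ?_ hj hk
          rw [hgi, hfi]
          linear_combination (-b j / b i) * hj + (-b k / b i) * hk
      · refine ⟨eval b (pderiv j g) / eval b (pderiv j f), ?_⟩
        have hj : eval b (pderiv j g) =
            eval b (pderiv j g) / eval b (pderiv j f) * eval b (pderiv j f) := by
          field_simp
        have hk : eval b (pderiv k g) =
            eval b (pderiv j g) / eval b (pderiv j f) * eval b (pderiv k f) := by
          field_simp; linear_combination hdet
        refine hsum _ ?_ hj hk
        rw [hgi, hfi]
        linear_combination (-b j / b i) * hj + (-b k / b i) * hk
    set δ := eval b (pderiv j f) * eval b (pderiv k g) -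
        eval b (pderiv k f) * eval b (pderiv j g) with hδ
    have hδu : IsUnit (φ (C δ)) := ((isUnit_iff_ne_zero.mpr hdet).map C).map φ
    have hyT : ∀ l, φ (X l - c l) ∈ T := by
      apply hsum
      · rw [hyi, map_zero]; exact zero_mem _
      · rw [← Ideal.unit_mul_mem_iff_mem _ hδu]
        have := sub_mem (Ideal.mul_mem_left T (φ (C (eval b (pderiv k g)))) hlf)
          (Ideal.mul_mem_left T (φ (C (eval b (pderiv k f)))) hlg)
        rw [← map_mul, ← map_mul, ← map_sub] at this
        rw [← map_mul]
        convert this using 2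
        simp only [hδ, C_sub, C_mul]
        ring
      · rw [← Ideal.unit_mul_mem_iff_mem _ hδu]
        have := sub_mem (Ideal.mul_mem_left T (φ (C (eval b (pderiv j f)))) hlg)
          (Ideal.mul_mem_left T (φ (C (eval b (pderiv j g)))) hlf)
        rw [← map_mul, ← map_mul, ← map_sub] at this
        rw [← map_mul]
        convert this using 2
        simp only [hδ, C_sub, C_mul]
        ring
    have hmT : m' ≤ T := by
      rw [← hmap, Ideal.map_le_iff_le_comap]
      refine hPspan.trans ?_
      rw [Ideal.span_le]
      rintro _ ⟨l, rfl⟩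
      exact hyT l
    exact Submodule.le_of_le_smul_of_le_jacobson_bot (IsNoetherian.noetherian _)
      (IsLocalRing.maximalIdeal_le_jacobson _) hmT
  · rintro ⟨c, hc⟩ heq
    have hv : ∀ l, ∃ r : K, ∀ q, eval b (pderiv q (C (b i) * X l - C (b l) * X i)) =
        r * eval b (pderiv q f) := by
      intro l
      set h : MvPolynomial (Fin 3) K := C (b i) * X l - C (b l) * X i with hh
      have hhP : h ∈ P := by
        rw [hPmem]
        simp only [hh, lineEval, map_sub, map_mul, aeval_X, algHom_C, Polynomial.algebraMap_eq]
        ring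
      have h1 : φ h ∈ Ideal.span {φ f, φ g} := by
        rw [heq, ← hmap]; exact Ideal.mem_map_of_mem _ hhP
      have h2 : φ h ∈ (Ideal.span {f, g}).map φ := by
        rw [Ideal.map_span, Set.image_pair]; exact h1
      rw [IsLocalization.algebraMap_mem_map_algebraMap_iff (lineCompl b)] at h2
      obtain ⟨u, hu, hmem⟩ := h2
      obtain ⟨α, β, hab⟩ := Ideal.mem_span_pair.mp hmem
      have hu' : lineEval b u * Polynomial.X ≠ 0 := mul_ne_zero hu Polynomial.X_ne_zero
      obtain ⟨t, ht⟩ : ∃ t, (lineEval b u * Polynomial.X).eval t ≠ 0 := by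
        by_contra hcon
        push Not at hcon
        exact hu' (Polynomial.funext (by simpa using hcon))
      rw [Polynomial.eval_mul, Polynomial.eval_X, lineEval_eval] at ht
      have hut := left_ne_zero_of_mul ht
      set b' : Fin 3 → K := fun l => b l * t with hb'
      have hfb : eval b' f = 0 := by rw [evalScale b t f hf, hbf, zero_mul]
      have hgb : eval b' g = 0 := by rw [evalScale b t g hg, hbg, zero_mul]
      have hhb : eval b' h = 0 := by simp [hh, hb']; ring
      refine ⟨(eval b' α * t ^ (n - 1) + eval b' β * t ^ (m - 1) * c) / eval b' u, fun q => ?_⟩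
      have h3 := congrArg (fun w => eval b' (pderiv q w)) hab
      simp only [map_add, pderiv_mul, map_mul, hfb, hgb, hhb, mul_zero, zero_add, add_zero] at h3
      rw [show eval b' (pderiv q f) = _ from evalScale b t _ hf.pderiv,
        show eval b' (pderiv q g) = _ from evalScale b t _ hg.pderiv, hc q] at h3
      have h4 : eval b' (pderiv q h) = eval b (pderiv q h) := by
        classical
        simp only [hh, map_sub, pderiv_C_mul, pderiv_X, map_mul, eval_C]
        by_cases h5 : q = l <;> by_cases h6 : q = i <;> simp [Pi.single_apply, h5, h6] <;> split_ifs <;> simp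
      rw [h4] at h3
      field_simp
      linear_combination -h3
    obtain ⟨r, hr⟩ := hv j
    obtain ⟨r', hr'⟩ := hv k
    have a1 := hr j
    have a2 := hr k
    have a3 := hr' k
    simp [pderiv_C_mul, pderiv_X_of_ne hij, pderiv_X_of_ne hik, pderiv_X_of_ne hjk] at a1 a2 a3
    rcases a2 with h | h
    · rw [h, zero_mul] at a1; exact hi a1
    · rw [h, mul_zero] at a3; exact hi a3

/-- for a normalized non-degenerate monoid surface `Z(x₀ f_{d-1} + f_d)` and a
base point `b`, the line `L_b` contains a singular point other than `O = (1:0:0:0)` iff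
`Z(f_{d-1})` is nonsingular at `b` and `I_b(f_{d-1}, f_d) > 1`. -/
theorem stmt6 [CharZero K] [IsAlgClosed K] {d : ℕ} (hd : 3 ≤ d)
    (f g : MvPolynomial (Fin 3) K)
    (hf : f.IsHomogeneous (d - 1)) (hg : g.IsHomogeneous d) (hf0 : f ≠ 0) (hg0 : g ≠ 0)
    (hgcd : ∀ q : MvPolynomial (Fin 3) K, q ∣ f → q ∣ g → IsUnit q)
    (hnocsing : ∀ b : Fin 3 → K, b ≠ 0 →
      ¬((eval b f = 0 ∧ ∀ j, eval b (pderiv j f) = 0) ∧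
        (eval b g = 0 ∧ ∀ j, eval b (pderiv j g) = 0)))
    (b : Fin 3 → K) (hb : b ≠ 0) (hbf : eval b f = 0) (hbg : eval b g = 0) :
    (∃ s t : K, t ≠ 0 ∧
        SingularAt (X 0 * rename Fin.succ f + rename Fin.succ g)
          (Fin.cons s fun j => t * b j)) ↔
      ((∃ j, eval b (pderiv j f) ≠ 0) ∧ (1 : WithBot ℕ∞) < interMult f g b) := by
  rw [singIff hd f g hf hg b hbf hbg]
  constructor
  · rintro ⟨c, hc⟩
    have hfs : ∃ j, eval b (pderiv j f) ≠ 0 := by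
      by_contra hcon
      push Not at hcon
      exact hnocsing b hb ⟨⟨hbf, hcon⟩, hbg, fun j => by rw [hc j, hcon j, mul_zero]⟩
    exact ⟨hfs, (localPart f g hf hg b hb hbf hbg hfs).mpr ⟨c, hc⟩⟩
  · rintro ⟨hfs, h⟩
    exact (localPart f g hf hg b hb hbf hbg hfs).mp h
end

section
/- Let F = x₀f_{d-1} + f_d define a normalized non-degenerate monoid surface and let P = (p₀:p₁:p₂:p₃) ≠ (1:0:0:0) be a singular point of Z(F) with I_{(p₁:p₂:p₃)}(f_{d-1}, f_d) = m. Then P is an A_{m−1} singularity, i.e., the Milnor number of the surface singularity at P equals m − 1 and the local equation is right equivalent to x² + y² + z^m. -/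
open MvPolynomial

variable {K : Type*} [Field K]

/-- The local (affine) equation of `Z(F)` at the point `P`, in the chart `x_r = 1`,
with coordinates centered at `P`. -/
noncomputable def localEq (F : MvPolynomial (Fin 4) K) (P : Fin 4 → K) (r : Fin 4) :
    MvPolynomial (Fin 3) K :=
  aeval (r.succAboveCases (1 : MvPolynomial (Fin 3) K)
    (fun j => C (P (r.succAbove j) / P r) + X j)) F

/-- The Milnor number of the germ at the origin defined by `g`: the dimension of the quotient
of the formal power series ring by the Jacobian ideal of `g`. -/
noncomputable def milnorNumber (g : MvPolynomial (Fin 3) K) : ℕ :=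
  Module.finrank K (MvPowerSeries (Fin 3) K ⧸
    Ideal.span (Set.range fun j : Fin 3 =>
      ((pderiv j g : MvPolynomial (Fin 3) K) : MvPowerSeries (Fin 3) K)))

/-- `g` defines an `A_n` singularity at the origin: it is right equivalent (under a formal
change of coordinates) to `x₁² + x₂² + x₃^{n+1}`. -/
def IsATypeSing (g : MvPolynomial (Fin 3) K) (n : ℕ) : Prop :=
  ∃ e : MvPowerSeries (Fin 3) K ≃ₐ[K] MvPowerSeries (Fin 3) K,
    e (g : MvPowerSeries (Fin 3) K) =
      (MvPowerSeries.X 0) ^ 2 + (MvPowerSeries.X 1) ^ 2 + (MvPowerSeries.X 2) ^ (n + 1)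

namespace MvPowerSeries

theorem aux_pow_diff {σ K : Type*} [Field K] [Finite σ] (u : σ → MvPowerSeries σ K)
    (hu : ∀ i, 2 ≤ (u i - X i).order) (n : σ →₀ ℕ) :
    ((n.degree + 1 : ℕ) : ℕ∞) ≤ (n.prod (fun s e => u s ^ e) - monomial n 1).order := by
  classical
  have hadd : ∀ f g : σ →₀ ℕ,
      ((f.degree + 1 : ℕ) : ℕ∞) ≤ (f.prod (fun s e => u s ^ e) - monomial f 1).order →
      ((g.degree + 1 : ℕ) : ℕ∞) ≤ (g.prod (fun s e => u s ^ e) - monomial g 1).order →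
      (((f + g).degree + 1 : ℕ) : ℕ∞) ≤
        ((f + g).prod (fun s e => u s ^ e) - monomial (f + g) 1).order := by
    intro f g hf hg
    have h1 : (g.degree : ℕ∞) ≤ (g.prod (fun s e => u s ^ e)).order := by
      have h : g.prod (fun s e => u s ^ e) =
          (g.prod (fun s e => u s ^ e) - monomial g 1) + monomial g 1 := by ring
      rw [h]
      refine le_trans (le_min (le_trans (by norm_cast; omega) hg) ?_) min_order_le_add
      rw [order_monomial_of_ne_zero one_ne_zero]
    have h2 : (f + g).prod (fun s e => u s ^ e) =
        f.prod (fun s e => u s ^ e) * g.prod (fun s e => u s ^ e) :=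
      Finsupp.prod_add_index' (by simp) (by intros; rw [pow_add])
    have h3 : (monomial (f + g) (1 : K)) = monomial f 1 * monomial g 1 := by
      rw [monomial_mul_monomial, one_mul]
    have h4 : (f + g).prod (fun s e => u s ^ e) - monomial (f + g) 1 =
        (f.prod (fun s e => u s ^ e) - monomial f 1) * g.prod (fun s e => u s ^ e)
        + monomial f 1 * (g.prod (fun s e => u s ^ e) - monomial g 1) := by
      rw [h2, h3]; ring
    rw [h4]
    refine le_trans (le_min ?_ ?_) min_order_le_add
    · refine le_trans ?_ le_order_mul
      refine le_trans ?_ (add_le_add hf h1)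
      rw [map_add]; norm_cast; omega
    · refine le_trans ?_ le_order_mul
      refine le_trans ?_ (add_le_add (order_monomial_of_ne_zero one_ne_zero).ge hg)
      rw [map_add]; norm_cast
  have hzero : (((0 : σ →₀ ℕ).degree + 1 : ℕ) : ℕ∞) ≤
      ((0 : σ →₀ ℕ).prod (fun s e => u s ^ e) - monomial 0 1).order := by
    simp
  induction n using Finsupp.induction_linear with
  | zero => exact hzero
  | add f g hf hg => exact hadd f g hf hg
  | single a b =>
    induction b with
    | zero => simp
    | succ b ih =>
      rw [Finsupp.single_add]
      refine hadd _ _ ih ?_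
      simpa [X] using hu a

theorem aux_hasSubst {σ K : Type*} [Field K] [Finite σ] {u : σ → MvPowerSeries σ K}
    (hu : ∀ i, 2 ≤ (u i - X i).order) : HasSubst u := by
  apply hasSubst_of_constantCoeff_zero
  intro i
  have h := coeff_of_lt_order (f := u i - X i) (d := 0)
    (lt_of_lt_of_le (by simp) (hu i))
  simpa using h

theorem aux_key {σ K : Type*} [Field K] [Finite σ] (u : σ → MvPowerSeries σ K)
    (hu : ∀ i, 2 ≤ (u i - X i).order) (k : ℕ) (f : MvPowerSeries σ K)
    (hf : (k : ℕ∞) ≤ f.order) : ((k + 1 : ℕ) : ℕ∞) ≤ (subst u f - f).order := by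
  classical
  apply nat_le_order
  intro e he
  rw [map_sub, coeff_subst (aux_hasSubst hu), finsum_eq_single _ e]
  · have h := coeff_of_lt_order (f := e.prod (fun s e => u s ^ e) - monomial e 1) (d := e)
      (lt_of_lt_of_le (by norm_cast; omega) (aux_pow_diff u hu e))
    rw [map_sub, coeff_monomial_same, sub_eq_zero] at h
    rw [h]; simp
  · intro n hn
    by_cases hk : n.degree < k
    · rw [coeff_of_lt_order (f := f) (d := n) (lt_of_lt_of_le (by exact_mod_cast hk) hf), zero_smul]
    · have h := coeff_of_lt_order (f := n.prod (fun s e => u s ^ e) - monomial n 1) (d := e)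
        (lt_of_lt_of_le (by norm_cast; omega) (aux_pow_diff u hu n))
      rw [map_sub, coeff_monomial, if_neg hn.symm, sub_zero] at h
      rw [h, smul_zero]

theorem aux_unip_bij {σ K : Type*} [Field K] [Finite σ] (u : σ → MvPowerSeries σ K)
    (hu : ∀ i, 2 ≤ (u i - X i).order) :
    Function.Bijective (substAlgHom (R := K) (aux_hasSubst hu)) := by
  classical
  set S := substAlgHom (R := K) (aux_hasSubst hu) with hS
  have key : ∀ (k : ℕ) (f : MvPowerSeries σ K), (k : ℕ∞) ≤ f.order →
      ((k + 1 : ℕ) : ℕ∞) ≤ (f - S f).order := by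
    intro k f hf
    have h := aux_key u hu k f hf
    rw [← order_neg] at h
    rw [hS, substAlgHom_apply]
    rwa [neg_sub] at h
  have key2 : ∀ (k : ℕ) (f : MvPowerSeries σ K), (k : ℕ∞) ≤ f.order → (k : ℕ∞) ≤ (S f).order := by
    intro k f hf
    have h : S f = f + -(f - S f) := by ring
    rw [h]
    refine le_trans (le_min hf ?_) min_order_le_add
    rw [order_neg]
    exact le_trans (by norm_cast; omega) (key k f hf)
  constructor
  · rw [injective_iff_map_eq_zero]
    intro f hf
    have h : ∀ k : ℕ, (k : ℕ∞) ≤ f.order := by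
      intro k
      induction k with
      | zero => simp
      | succ k ih => simpa [hf] using key k f ih
    ext e
    rw [coeff_of_lt_order (f := f) (d := e) (lt_of_lt_of_le (by norm_cast; omega) (h (e.degree + 1)))]
    simp
  · intro f
    let a : ℕ → MvPowerSeries σ K := fun k => (fun f => f - S f)^[k] f
    have ha0 : a 0 = f := rfl
    have has : ∀ k, a (k + 1) = a k - S (a k) := by
      intro k
      simp only [a, Function.iterate_succ', Function.comp]
    have hao : ∀ k : ℕ, (k : ℕ∞) ≤ (a k).order := by
      intro k
      induction k with
      | zero => simp
      | succ k ih => rw [has]; exact key k _ ih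
    let g : MvPowerSeries σ K := fun n => ∑ k ∈ Finset.range (n.degree + 1), coeff n (a k)
    have hg : ∀ n, coeff n g = ∑ k ∈ Finset.range (n.degree + 1), coeff n (a k) := fun n => rfl
    refine ⟨g, ?_⟩
    ext n
    set T := ∑ k ∈ Finset.range (n.degree + 1), a k with hT
    have h1 : ((n.degree + 1 : ℕ) : ℕ∞) ≤ (g - T).order := by
      apply nat_le_order
      intro e he
      rw [map_sub, hg, hT, map_sum, sub_eq_zero]
      apply Finset.sum_subset
      · intro x; simp only [Finset.mem_range]; omega
      · intro x _ hx
        simp only [Finset.mem_range] at hx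
        exact coeff_of_lt_order (lt_of_lt_of_le (by norm_cast; omega) (hao x))
    have h2 : S T = f - a (n.degree + 1) := by
      rw [hT, map_sum, ← ha0, ← Finset.sum_range_sub']
      apply Finset.sum_congr rfl
      intro k _
      rw [has]; ring
    have h3 : S g = S (g - T) + (f - a (n.degree + 1)) := by
      rw [← h2, ← map_add]; congr 1; ring
    have h4 : coeff n (S (g - T)) = 0 :=
      coeff_of_lt_order (lt_of_lt_of_le (by norm_cast; omega) (key2 _ _ h1))
    have h5 : coeff n (a (n.degree + 1)) = 0 :=
      coeff_of_lt_order (lt_of_lt_of_le (by norm_cast; omega) (hao (n.degree + 1)))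
    rw [h3, map_add, h4, map_sub, h5]
    ring
end MvPowerSeries
namespace MvPowerSeries

theorem aux_degree_one {σ : Type*} (d : σ →₀ ℕ) (h : d.degree < 2) :
    d = 0 ∨ ∃ j, d = Finsupp.single j 1 := by
  classical
  by_cases h0 : d = 0
  · exact Or.inl h0
  · right
    obtain ⟨j, hj⟩ := Finsupp.ne_iff.mp h0
    refine ⟨j, ?_⟩
    have h1 : d = Finsupp.single j 1 + (d - Finsupp.single j 1) := by
      rw [add_tsub_cancel_of_le]
      rw [Finsupp.single_le_iff]
      simp at hj; omega
    have h2 : (d - Finsupp.single j 1).degree = 0 := by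
      have := congrArg Finsupp.degree h1
      rw [map_add, Finsupp.degree_single] at this
      omega
    rw [Finsupp.degree_eq_zero_iff] at h2
    rw [h1, h2, add_zero]

/-- linear substitution attached to a matrix -/
noncomputable def linSub {σ K : Type*} [Field K] [Fintype σ] (A : Matrix σ σ K) (i : σ) :
    MvPowerSeries σ K := ∑ j, A i j • X j

theorem linSub_hasSubst {σ K : Type*} [Field K] [Fintype σ] (A : Matrix σ σ K) :
    HasSubst (linSub A) := by
  apply hasSubst_of_constantCoeff_zero
  intro i
  simp [linSub]

theorem linSub_comp {σ K : Type*} [Field K] [Fintype σ] [DecidableEq σ] (A B : Matrix σ σ K)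
    (h : B * A = 1) (f : MvPowerSeries σ K) :
    substAlgHom (R := K) (linSub_hasSubst A) (substAlgHom (R := K) (linSub_hasSubst B) f) = f := by
  rw [substAlgHom_apply, substAlgHom_apply,
    subst_comp_subst_apply (linSub_hasSubst B) (linSub_hasSubst A)]
  have : (fun s => subst (linSub A) (linSub B s)) = (X : σ → MvPowerSeries σ K) := by
    funext s
    rw [← substAlgHom_apply (R := K) (linSub_hasSubst A)]
    conv_lhs => rw [linSub]
    simp only [map_sum, map_smul, substAlgHom_X]
    simp only [linSub, Finset.smul_sum, smul_smul]
    rw [Finset.sum_comm]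
    simp only [← Finset.sum_smul]
    have h2 : ∀ j, ∑ k, B s k * A k j = (1 : Matrix σ σ K) s j := by
      intro j; rw [← h, Matrix.mul_apply]
    simp [h2, Matrix.one_apply]
  rw [this, subst_self]; rfl

theorem formal_inverse {σ K : Type*} [Field K] [Fintype σ] [DecidableEq σ]
    (u : σ → MvPowerSeries σ K)
    (h0 : ∀ i, constantCoeff (u i) = 0)
    (J : Matrix σ σ K) (hJ : ∀ i j, J i j = coeff (Finsupp.single j 1) (u i))
    (hdet : IsUnit J.det) :
    ∃ e : MvPowerSeries σ K ≃ₐ[K] MvPowerSeries σ K, ∀ i, e (X i) = u i := by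
  have hs : HasSubst u := hasSubst_of_constantCoeff_zero h0
  let S := substAlgHom (R := K) hs
  let T := substAlgHom (R := K) (linSub_hasSubst J⁻¹)
  have hT : Function.Bijective T := by
    refine Function.bijective_iff_has_inverse.mpr
      ⟨substAlgHom (R := K) (linSub_hasSubst J), ?_, ?_⟩
    · intro f; exact linSub_comp _ _ (Matrix.nonsing_inv_mul _ hdet) f
    · intro f; exact linSub_comp _ _ (Matrix.mul_nonsing_inv _ hdet) f
  let w : σ → MvPowerSeries σ K := fun i => subst u (linSub J⁻¹ i)
  have hw' : ∀ i, w i = ∑ j, J⁻¹ i j • u j := by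
    intro i
    simp only [w]
    rw [← substAlgHom_apply (R := K) hs]
    conv_lhs => rw [linSub]
    simp only [map_sum, map_smul, substAlgHom_X]
  have hw : ∀ i, 2 ≤ (w i - X i).order := by
    intro i
    refine nat_le_order (n := 2) ?_
    intro d hd
    rw [map_sub, hw', map_sum]
    rcases aux_degree_one d hd with rfl | ⟨j, rfl⟩
    · simp [h0]
    · simp only [coeff_smul, ← hJ]
      rw [← Matrix.mul_apply, Matrix.nonsing_inv_mul _ hdet, Matrix.one_apply, coeff_X, sub_eq_zero]
      simp [Finsupp.single_left_inj, eq_comm]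
  have hST : ∀ f, S (T f) = substAlgHom (R := K) (aux_hasSubst hw) f := by
    intro f
    simp only [S, T, substAlgHom_apply]
    rw [subst_comp_subst_apply (linSub_hasSubst _) hs]
  have hcomp : Function.Bijective (S ∘ T) := by
    have := aux_unip_bij w hw
    have h : (S ∘ T) = substAlgHom (R := K) (aux_hasSubst hw) := funext hST
    rw [h]; exact this
  have hS : Function.Bijective S := (Function.Bijective.of_comp_iff _ hT).mp hcomp
  exact ⟨AlgEquiv.ofBijective S hS, fun i => substAlgHom_X hs i⟩

theorem formal_root {σ K : Type*} [Field K] [CharZero K] [IsAlgClosed K] [Finite σ]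
    (s : MvPowerSeries σ K) (hs : constantCoeff s ≠ 0) (m : ℕ) (hm : m ≠ 0) :
    ∃ t : MvPowerSeries σ K, t ^ m = s := by
  obtain ⟨α, hα⟩ := IsAlgClosed.exists_pow_nat_eq (constantCoeff s) (Nat.pos_of_ne_zero hm)
  set a := constantCoeff s with ha
  let y : MvPowerSeries σ K := C a⁻¹ * s - 1
  have hy : PowerSeries.HasSubst y := by
    apply PowerSeries.HasSubst.of_constantCoeff_zero
    simp [y, ← ha, hs]
  have hpow : ∀ k : ℕ, (PowerSeries.binomialSeries K (1 / (m : ℚ))) ^ k =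
      PowerSeries.binomialSeries K ((k : ℚ) / m) := by
    intro k
    induction k with
    | zero => simp
    | succ k ih =>
      rw [pow_succ, ih, ← PowerSeries.binomialSeries_add]
      congr 1
      push_cast; ring
  have hm' : (PowerSeries.binomialSeries K (1 / (m : ℚ))) ^ m = 1 + PowerSeries.X := by
    rw [hpow, div_self (by exact_mod_cast hm)]
    have := PowerSeries.binomialSeries_nat (R := ℚ) (A := K) 1
    simpa using this
  let r : MvPowerSeries σ K := PowerSeries.substAlgHom (R := K) hy (PowerSeries.binomialSeries K (1 / (m : ℚ)))
  have hr : r ^ m = 1 + y := by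
    simp only [r]
    rw [← map_pow, hm', map_add, map_one, PowerSeries.substAlgHom_X]
  refine ⟨C α * r, ?_⟩
  rw [mul_pow, hr, ← map_pow, hα]
  simp only [y]
  have : C a * C a⁻¹ = (1 : MvPowerSeries σ K) := by rw [← map_mul, mul_inv_cancel₀ hs, map_one]
  linear_combination s * this

/-- the normal form -/
theorem formal_normal_form {K : Type*} [Field K] [CharZero K] [IsAlgClosed K]
    (u : Fin 3 → MvPowerSeries (Fin 3) K) (s : MvPowerSeries (Fin 3) K)
    (hs : constantCoeff s ≠ 0) (h0 : ∀ i, constantCoeff (u i) = 0)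
    (J : Matrix (Fin 3) (Fin 3) K) (hJ : ∀ i j, J i j = coeff (Finsupp.single j 1) (u i))
    (hdet : IsUnit J.det) (m : ℕ) (hm : m ≠ 0) :
    ∃ e : MvPowerSeries (Fin 3) K ≃ₐ[K] MvPowerSeries (Fin 3) K,
      e (u 0 * u 1 + s * u 2 ^ m) = X 0 ^ 2 + X 1 ^ 2 + X 2 ^ m := by
  obtain ⟨t, ht⟩ := formal_root s hs m hm
  obtain ⟨I, hI⟩ := IsAlgClosed.exists_pow_nat_eq (-1 : K) (n := 2) (by norm_num)
  have ht0 : constantCoeff t ≠ 0 := by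
    intro h; apply hs; rw [← ht, map_pow, h, zero_pow hm]
  have hI0 : I ≠ 0 := by rintro rfl; norm_num at hI
  -- new coordinates
  let v : Fin 3 → MvPowerSeries (Fin 3) K :=
    ![C (1/2) * (u 0 + u 1), C (I/2) * (u 0 - u 1), t * u 2]
  let M : Matrix (Fin 3) (Fin 3) K := !![1/2, 1/2, 0; I/2, -(I/2), 0; 0, 0, constantCoeff t]
  have hcm : ∀ (a b : MvPowerSeries (Fin 3) K) (j : Fin 3), constantCoeff b = 0 →
      coeff (Finsupp.single j 1) (a * b) = constantCoeff a * coeff (Finsupp.single j 1) b := by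
    intro a b j hb
    rw [coeff_mul, Finsupp.antidiagonal_single]
    simp [Finset.Nat.antidiagonal_succ, hb]
  have hv0 : ∀ i, constantCoeff (v i) = 0 := by
    intro i
    fin_cases i <;> simp [v, h0]
  have hvJ : ∀ i j, (M * J) i j = coeff (Finsupp.single j 1) (v i) := by
    intro i j
    rw [Matrix.mul_apply, Fin.sum_univ_three]
    simp only [hJ]
    fin_cases i
    · simp [M, v]; ring
    · simp [M, v]; ring
    · simp [M, v, hcm _ _ _ (h0 2)]
  have hM : M.det = -(I/2) * constantCoeff t := by
    simp [M, Matrix.det_fin_three]; ring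
  have hdet' : IsUnit (M * J).det := by
    rw [Matrix.det_mul, hM]
    exact (isUnit_iff_ne_zero.mpr (by
      apply mul_ne_zero _ ht0
      simp [hI0])).mul hdet
  obtain ⟨e, he⟩ := formal_inverse v hv0 (M * J) hvJ hdet'
  refine ⟨e.symm, ?_⟩
  rw [AlgEquiv.symm_apply_eq]
  simp only [map_add, map_pow, he]
  simp only [v, Matrix.cons_val_zero, Matrix.cons_val_one, Matrix.cons_val]
  rw [mul_pow, mul_pow, mul_pow, ht, ← map_pow, ← map_pow]
  have h1 : (I / 2) ^ 2 = - (1/2)^2 := by rw [div_pow, hI]; ring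
  rw [h1]
  have h4 : C ((1/2 : K)^2) * 4 = (1 : MvPowerSeries (Fin 3) K) := by
    have : (4 : MvPowerSeries (Fin 3) K) = C 4 := (map_ofNat C 4).symm
    rw [this, ← map_mul]; norm_num
  rw [map_neg]
  linear_combination (- u 0 * u 1) * h4
end MvPowerSeries
namespace MvPowerSeries

/-- Jacobian ideal -/
noncomputable def jacI {K : Type*} [Field K] (g : MvPolynomial (Fin 3) K) :
    Ideal (MvPowerSeries (Fin 3) K) :=
  Ideal.span (Set.range fun j : Fin 3 =>
      ((MvPolynomial.pderiv j g : MvPolynomial (Fin 3) K) : MvPowerSeries (Fin 3) K))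

theorem deriv_coe {K : Type*} [Field K]
    (D : Derivation K (MvPowerSeries (Fin 3) K) (MvPowerSeries (Fin 3) K))
    (g : MvPolynomial (Fin 3) K) :
    D (g : MvPowerSeries (Fin 3) K) =
      ∑ j, ((MvPolynomial.pderiv j g : MvPolynomial (Fin 3) K) : MvPowerSeries (Fin 3) K) * D (X j) := by
  induction g using MvPolynomial.induction_on with
  | C a =>
    have : ((MvPolynomial.C a : MvPolynomial (Fin 3) K) : MvPowerSeries (Fin 3) K)
        = algebraMap K _ a := by simp [MvPowerSeries.algebraMap_apply]
    rw [this, D.map_algebraMap]; simp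
  | add p q hp hq =>
    simp only [MvPolynomial.coe_add, map_add, hp, hq, add_mul, Finset.sum_add_distrib]
  | mul_X p i hp =>
    simp only [MvPolynomial.coe_mul, MvPolynomial.coe_X, Derivation.leibniz, hp, smul_eq_mul,
      MvPolynomial.coe_add, add_mul, Finset.sum_add_distrib, MvPolynomial.pderiv_X]
    congr 1
    · rw [Finset.sum_eq_single i]
      · simp
      · intro b _ hb
        rw [Pi.single_eq_of_ne hb.symm]
        simp
      · simp
    · rw [Finset.mul_sum]
      apply Finset.sum_congr rfl
      intros; ring

theorem mem_jacI {K : Type*} [Field K] (g : MvPolynomial (Fin 3) K) (x : MvPowerSeries (Fin 3) K) :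
    x ∈ jacI g ↔ ∃ D : Derivation K (MvPowerSeries (Fin 3) K) (MvPowerSeries (Fin 3) K),
      D (g : MvPowerSeries (Fin 3) K) = x := by
  constructor
  · intro hx
    rw [jacI, Ideal.mem_span_range_iff_exists_fun] at hx
    obtain ⟨c, hc⟩ := hx
    refine ⟨∑ j, c j • MvPowerSeries.pderiv K j, ?_⟩
    rw [← hc, Fin.sum_univ_three, Fin.sum_univ_three]
    simp [MvPowerSeries.pderiv_coe]
  · rintro ⟨D, rfl⟩
    rw [deriv_coe]
    exact Ideal.sum_mem _ fun j _ => Ideal.mul_mem_right _ _ (Ideal.subset_span ⟨j, rfl⟩)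

/-- conjugate derivation -/
noncomputable def conjDer {K A : Type*} [Field K] [CommRing A] [Algebra K A] (e : A ≃ₐ[K] A)
    (D : Derivation K A A) : Derivation K A A :=
  Derivation.mk' (e.toLinearMap ∘ₗ D.toLinearMap ∘ₗ e.symm.toLinearMap) (by
    intro a b
    simp [Derivation.leibniz])

theorem conjDer_apply {K A : Type*} [Field K] [CommRing A] [Algebra K A] (e : A ≃ₐ[K] A)
    (D : Derivation K A A) (a : A) : conjDer e D a = e (D (e.symm a)) := rfl

theorem jacI_map {K : Type*} [Field K] (g h : MvPolynomial (Fin 3) K)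
    (e : MvPowerSeries (Fin 3) K ≃ₐ[K] MvPowerSeries (Fin 3) K)
    (he : e (g : MvPowerSeries (Fin 3) K) = (h : MvPowerSeries (Fin 3) K)) :
    jacI h = (jacI g).map (e : MvPowerSeries (Fin 3) K →+* MvPowerSeries (Fin 3) K) := by
  ext x
  have hmap : x ∈ (jacI g).map (e : MvPowerSeries (Fin 3) K →+* MvPowerSeries (Fin 3) K) ↔
      ∃ y ∈ jacI g, e y = x := by
    have := Ideal.mem_map_iff_of_surjective (I := jacI g) (e : MvPowerSeries (Fin 3) K →+* MvPowerSeries (Fin 3) K)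
      e.surjective (y := x)
    simpa using this
  rw [hmap]
  constructor
  · intro hx
    rw [mem_jacI] at hx
    obtain ⟨D, hD⟩ := hx
    refine ⟨e.symm x, ?_, by simp⟩
    rw [mem_jacI]
    refine ⟨conjDer e.symm D, ?_⟩
    rw [conjDer_apply, AlgEquiv.symm_symm, he, hD]
  · rintro ⟨y, hy, rfl⟩
    rw [mem_jacI] at hy ⊢
    obtain ⟨D, hD⟩ := hy
    refine ⟨conjDer e D, ?_⟩
    rw [conjDer_apply, ← he, AlgEquiv.symm_apply_apply, hD]

theorem finrank_normal {K : Type*} [Field K] [CharZero K] (n : ℕ) :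
    Module.finrank K (MvPowerSeries (Fin 3) K ⧸ jacI
      (MvPolynomial.X 0 ^ 2 + MvPolynomial.X 1 ^ 2 + MvPolynomial.X 2 ^ (n + 1) :
        MvPolynomial (Fin 3) K)) = n := by
  classical
  set I := jacI (MvPolynomial.X 0 ^ 2 + MvPolynomial.X 1 ^ 2 + MvPolynomial.X 2 ^ (n + 1) :
        MvPolynomial (Fin 3) K) with hI
  have hC : ∀ (a : K), a ≠ 0 → ∀ x, C a * x ∈ I → x ∈ I := by
    intro a ha x hx
    have := I.mul_mem_left (C a⁻¹) hx
    rwa [← mul_assoc, ← map_mul, inv_mul_cancel₀ ha, map_one, one_mul] at this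
  have hgen : ∀ j, ((MvPolynomial.pderiv j (MvPolynomial.X 0 ^ 2 + MvPolynomial.X 1 ^ 2 + MvPolynomial.X 2 ^ (n + 1) :
        MvPolynomial (Fin 3) K) : MvPolynomial (Fin 3) K) : MvPowerSeries (Fin 3) K) =
        (![C 2 * X 0, C 2 * X 1, C ((n + 1 : ℕ) : K) * X 2 ^ n] : Fin 3 → MvPowerSeries (Fin 3) K) j := by
    intro j
    have h2 : ((2 : MvPolynomial (Fin 3) K) : MvPowerSeries (Fin 3) K) = C 2 :=
      (map_ofNat (MvPolynomial.coeToMvPowerSeries.ringHom (R := K) (σ := Fin 3)) 2).trans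
        (map_ofNat C 2).symm
    have hn : ((n : MvPolynomial (Fin 3) K) : MvPowerSeries (Fin 3) K) = n :=
      map_natCast (MvPolynomial.coeToMvPowerSeries.ringHom (R := K) (σ := Fin 3)) n
    fin_cases j
    · simp [MvPolynomial.pderiv_X, h2]
    · simp [MvPolynomial.pderiv_X, h2]
    · simp [MvPolynomial.pderiv_X, hn]
  have hmem : ∀ j, (![C 2 * X 0, C 2 * X 1, C ((n + 1 : ℕ) : K) * X 2 ^ n] : Fin 3 → MvPowerSeries (Fin 3) K) j ∈ I := by
    intro j
    rw [← hgen]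
    exact Ideal.subset_span ⟨j, rfl⟩
  have hX0 : (X 0 : MvPowerSeries (Fin 3) K) ∈ I := hC 2 two_ne_zero _ (hmem 0)
  have hX1 : (X 1 : MvPowerSeries (Fin 3) K) ∈ I := hC 2 two_ne_zero _ (hmem 1)
  have hX2 : (X 2 ^ n : MvPowerSeries (Fin 3) K) ∈ I :=
    hC _ (by exact_mod_cast Nat.succ_ne_zero n) _ (hmem 2)
  let φ : MvPowerSeries (Fin 3) K →ₗ[K] (Fin n → K) :=
    LinearMap.pi fun i => coeff (Finsupp.single 2 (i : ℕ))
  have hφ : ∀ f i, φ f i = coeff (Finsupp.single 2 (i : ℕ)) f := fun f i => rfl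
  have hsurj : Function.Surjective φ := by
    intro c
    let f : MvPowerSeries (Fin 3) K := fun d => if h : d 2 < n then c ⟨d 2, h⟩ else 0
    refine ⟨f, ?_⟩
    funext i
    rw [hφ]
    change (if h : (Finsupp.single (2 : Fin 3) (i : ℕ)) 2 < n then c ⟨_, h⟩ else 0) = c i
    simp
  have hker : LinearMap.ker φ = I.restrictScalars K := by
    ext f
    rw [LinearMap.mem_ker, Submodule.restrictScalars_mem]
    constructor
    · intro hf
      let f0 : MvPowerSeries (Fin 3) K := fun d => if d 0 = 0 then 0 else coeff d f
      let f1 : MvPowerSeries (Fin 3) K := fun d => if d 0 = 0 then (if d 1 = 0 then 0 else coeff d f) else 0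
      let f2 : MvPowerSeries (Fin 3) K := fun d => if d 0 = 0 then (if d 1 = 0 then coeff d f else 0) else 0
      have e0 : ∀ d, coeff d f0 = if d 0 = 0 then 0 else coeff d f := fun d => rfl
      have e1 : ∀ d, coeff d f1 = if d 0 = 0 then (if d 1 = 0 then 0 else coeff d f) else 0 := fun d => rfl
      have e2 : ∀ d, coeff d f2 = if d 0 = 0 then (if d 1 = 0 then coeff d f else 0) else 0 := fun d => rfl
      have hsum : f = f0 + f1 + f2 := by
        ext d
        simp only [map_add, e0, e1, e2]
        split_ifs <;> simp
      have d0 : X 0 ∣ f0 := by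
        rw [X_dvd_iff]; intro d hd; rw [e0, if_pos hd]
      have d1 : X 1 ∣ f1 := by
        rw [X_dvd_iff]; intro d hd; rw [e1]; simp [hd]
      have d2 : X 2 ^ n ∣ f2 := by
        rw [X_pow_dvd_iff]; intro d hd; rw [e2]
        split_ifs with h0 h1
        · have := congrFun hf ⟨d 2, hd⟩
          rw [hφ] at this
          have hd' : d = Finsupp.single 2 (d 2) := by
            ext i; fin_cases i <;> simp [h0, h1]
          rw [hd']; simpa using this
        · rfl
        · rfl
      rw [hsum]
      exact I.add_mem (I.add_mem (I.mem_of_dvd d0 hX0) (I.mem_of_dvd d1 hX1)) (I.mem_of_dvd d2 hX2)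
    · intro hf
      rw [hI, jacI, Ideal.mem_span_range_iff_exists_fun] at hf
      obtain ⟨c, rfl⟩ := hf
      funext i
      rw [hφ, map_sum, Fin.sum_univ_three]
      simp only [hgen]
      have k0 : coeff (Finsupp.single (2 : Fin 3) (i : ℕ)) (c 0 * (C 2 * X 0)) = 0 :=
        X_dvd_iff.mp (Dvd.intro_left (c 0 * C 2) (by ring)) _ (by simp)
      have k1 : coeff (Finsupp.single (2 : Fin 3) (i : ℕ)) (c 1 * (C 2 * X 1)) = 0 :=
        X_dvd_iff.mp (Dvd.intro_left (c 1 * C 2) (by ring)) _ (by simp)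
      have k2 : coeff (Finsupp.single (2 : Fin 3) (i : ℕ)) (c 2 * (C ((n + 1 : ℕ) : K) * X 2 ^ n)) = 0 :=
        X_pow_dvd_iff.mp (Dvd.intro_left (c 2 * C ((n + 1 : ℕ) : K)) (by ring)) _ (by simp)
      simp only [Matrix.cons_val_zero, Matrix.cons_val_one, Matrix.cons_val, k0, k1, k2]
      simp
  have e1 : (MvPowerSeries (Fin 3) K ⧸ I) ≃ₗ[K] (MvPowerSeries (Fin 3) K ⧸ LinearMap.ker φ) :=
    (Submodule.Quotient.restrictScalarsEquiv K I).symm.trans (Submodule.quotEquivOfEq _ _ hker.symm)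
  rw [(e1.trans (φ.quotKerEquivOfSurjective hsurj)).finrank_eq]
  simp

theorem milnor_of_equiv {K : Type*} [Field K] [CharZero K] (g : MvPolynomial (Fin 3) K) (n : ℕ)
    (e : MvPowerSeries (Fin 3) K ≃ₐ[K] MvPowerSeries (Fin 3) K)
    (he : e (g : MvPowerSeries (Fin 3) K) =
      (MvPowerSeries.X 0) ^ 2 + (MvPowerSeries.X 1) ^ 2 + (MvPowerSeries.X 2) ^ (n + 1)) :
    Module.finrank K (MvPowerSeries (Fin 3) K ⧸ jacI g) = n := by
  have h := jacI_map g (MvPolynomial.X 0 ^ 2 + MvPolynomial.X 1 ^ 2 + MvPolynomial.X 2 ^ (n + 1)) e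
    (by rw [he]; simp)
  rw [← finrank_normal (K := K) n]
  exact (Ideal.quotientEquivAlg _ _ e h).toLinearEquiv.finrank_eq
end MvPowerSeries
section localD

theorem local_pow_eq_zero {A : Type*} [CommRing A] [IsLocalRing A] (z : A)
    (hz : IsLocalRing.maximalIdeal A = Ideal.span {z}) (i : ℕ)
    (h : z ^ i ∈ Ideal.span {z ^ (i + 1)}) : z ^ i = 0 := by
  rw [Ideal.mem_span_singleton] at h
  obtain ⟨y, hy⟩ := h
  have hu : IsUnit (1 - z * y) := by
    by_contra hn
    have h1 : (1 - z * y) ∈ IsLocalRing.maximalIdeal A := hn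
    have h2 : z * y ∈ IsLocalRing.maximalIdeal A := by
      rw [hz]; exact Ideal.mul_mem_right _ _ (Ideal.subset_span rfl)
    have h3 := Ideal.add_mem _ h1 h2
    rw [sub_add_cancel] at h3
    exact (Ideal.ne_top_iff_one _).mp (IsLocalRing.maximalIdeal.isMaximal A).ne_top h3
  have h4 : z ^ i * (1 - z * y) = 0 := by linear_combination hy
  exact (hu.mul_left_eq_zero).mp h4

theorem local_decomp {A : Type*} [CommRing A] [IsLocalRing A] (z : A)
    (hz : IsLocalRing.maximalIdeal A = Ideal.span {z}) (x : A) (k : ℕ) :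
    (∃ a, x = a * z ^ k) ∨ ∃ i < k, ∃ s, IsUnit s ∧ x = s * z ^ i := by
  induction k with
  | zero => left; exact ⟨x, by simp⟩
  | succ k ih =>
    rcases ih with ⟨a, ha⟩ | ⟨i, hi, s, hs, hx⟩
    · by_cases hu : IsUnit a
      · right; exact ⟨k, by omega, a, hu, ha⟩
      · left
        have h1 : a ∈ IsLocalRing.maximalIdeal A := hu
        rw [hz, Ideal.mem_span_singleton] at h1
        obtain ⟨b, rfl⟩ := h1
        exact ⟨b, by rw [ha]; ring⟩
    · right; exact ⟨i, by omega, s, hs, hx⟩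

theorem local_krullDim_le {A : Type*} [CommRing A] [IsLocalRing A] (z : A)
    (hz : IsLocalRing.maximalIdeal A = Ideal.span {z}) (k : ℕ) (hk : z ^ k = 0) :
    Order.krullDim (Ideal A) ≤ (k : ℕ∞) := by
  classical
  have hex : ∀ I : Ideal A, ∃ i, z ^ i ∈ I := fun I => ⟨k, by rw [hk]; exact I.zero_mem⟩
  have hle : ∀ I : Ideal A, Nat.find (hex I) ≤ k := fun I =>
    Nat.find_min' _ (by rw [hk]; exact I.zero_mem)
  let F : Ideal A → Fin (k + 1) := fun I => ⟨k - Nat.find (hex I), by omega⟩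
  have hF : StrictMono F := by
    intro I J hIJ
    obtain ⟨x, hxJ, hxI⟩ := Set.exists_of_ssubset hIJ
    rcases local_decomp z hz x k with ⟨a, ha⟩ | ⟨i, hi, s, hs, hx⟩
    · exfalso; apply hxI; rw [ha, hk, mul_zero]; exact I.zero_mem
    · have h1 : z ^ i ∈ J := by
        rw [hx] at hxJ
        exact (Ideal.unit_mul_mem_iff_mem J hs).mp hxJ
      have h2 : z ^ i ∉ I := by
        intro h; apply hxI; change x ∈ I; rw [hx]; exact I.mul_mem_left _ h
      have h3 : Nat.find (hex J) ≤ i := Nat.find_min' _ h1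
      have h4 : i < Nat.find (hex I) := by
        by_contra hn
        push Not at hn
        exact h2 (Ideal.mem_of_dvd _ (pow_dvd_pow z hn) (Nat.find_spec (hex I)))
      change k - Nat.find (hex I) < k - Nat.find (hex J)
      have := hle I
      omega
  have := Order.krullDim_le_of_strictMono F hF
  refine this.trans ?_
  refine iSup_le fun p => ?_
  have h := p.length_lt_card
  rw [Fintype.card_fin] at h
  have h' : p.length ≤ k := by omega
  exact_mod_cast h'

theorem local_le_krullDim {A : Type*} [CommRing A] [IsLocalRing A] (z : A)
    (hz : IsLocalRing.maximalIdeal A = Ideal.span {z}) (k : ℕ) (hk : ∀ i < k, z ^ i ≠ 0) :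
    ((k : ℕ∞) : WithBot ℕ∞) ≤ Order.krullDim (Ideal A) := by
  let l : LTSeries (Ideal A) :=
    { length := k
      toFun := fun i => Ideal.span {z ^ (k - (i : ℕ))}
      step := by
        intro i
        change Ideal.span {z ^ (k - (i : ℕ))} < Ideal.span {z ^ (k - ((i : ℕ) + 1))}
        obtain ⟨j, hj⟩ : ∃ j, k - (i : ℕ) = j + 1 := ⟨k - i - 1, by omega⟩
        have hj' : k - ((i : ℕ) + 1) = j := by omega
        rw [hj, hj']
        refine lt_of_le_of_ne ?_ ?_
        · rw [Ideal.span_singleton_le_span_singleton]; exact pow_dvd_pow z (by omega)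
        · intro h
          refine hk j (by omega) (local_pow_eq_zero z hz j ?_)
          rw [h]; exact Ideal.subset_span rfl }
  exact Order.LTSeries.length_le_krullDim l

theorem local_length {A : Type*} [CommRing A] [IsLocalRing A] (z : A)
    (hz : IsLocalRing.maximalIdeal A = Ideal.span {z}) (m : ℕ)
    (hm : Order.krullDim (Ideal A) = (m : ℕ∞)) : z ^ m = 0 ∧ ∀ k < m, z ^ k ≠ 0 := by
  have h2 : ∀ k < m, z ^ k ≠ 0 := by
    intro k hk h
    have := local_krullDim_le z hz k h
    rw [hm] at this
    have h' : m ≤ k := by exact_mod_cast this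
    omega
  refine ⟨?_, h2⟩
  by_contra hne
  have := local_le_krullDim z hz (m + 1) (by
    intro i hi
    rcases Nat.lt_succ_iff_lt_or_eq.mp hi with h | rfl
    · exact h2 i h
    · exact hne)
  rw [hm] at this
  have h' : m + 1 ≤ m := by exact_mod_cast this
  omega

theorem local_main {A : Type*} [CommRing A] [IsLocalRing A] (f g l : A)
    (hmax : IsLocalRing.maximalIdeal A = Ideal.span {f, l})
    (hg : g ∈ IsLocalRing.maximalIdeal A) (hl : ∀ k : ℕ, l ^ k ∉ Ideal.span {f}) (m : ℕ)
    (hm : Order.krullDim (Ideal (A ⧸ Ideal.span {f, g})) = (m : ℕ∞)) :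
    ∃ s b, IsUnit s ∧ g = s * l ^ m + b * f := by
  have hf : f ∈ IsLocalRing.maximalIdeal A := by rw [hmax]; exact Ideal.subset_span (by simp)
  have hle : Ideal.span {f, g} ≤ IsLocalRing.maximalIdeal A := by
    rw [Ideal.span_le]; rintro x (rfl | rfl)
    · exact hf
    · exact hg
  have hnt : Nontrivial (A ⧸ Ideal.span {f, g}) := by
    rw [Ideal.Quotient.nontrivial_iff]
    intro h; rw [h, top_le_iff] at hle
    exact (IsLocalRing.maximalIdeal.isMaximal A).ne_top hle
  have hloc : IsLocalRing (A ⧸ Ideal.span {f, g}) :=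
    IsLocalRing.of_surjective' (Ideal.Quotient.mk _) Ideal.Quotient.mk_surjective
  have hmax' : IsLocalRing.maximalIdeal (A ⧸ Ideal.span {f, g}) =
      Ideal.span {Ideal.Quotient.mk (Ideal.span {f, g}) l} := by
    have h1 : Ideal.map (Ideal.Quotient.mk (Ideal.span {f, g})) (IsLocalRing.maximalIdeal A) =
      Ideal.span {Ideal.Quotient.mk (Ideal.span {f, g}) l} := by
      rw [hmax, Ideal.map_span, Set.image_pair]
      have : Ideal.Quotient.mk (Ideal.span {f, g}) f = 0 :=
        Ideal.Quotient.eq_zero_iff_mem.mpr (Ideal.subset_span (by simp))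
      rw [this]
      exact Ideal.span_insert_zero
    rw [← h1]
    symm
    have := IsLocalRing.eq_maximalIdeal (R := A ⧸ Ideal.span {f, g})
      (I := Ideal.map (Ideal.Quotient.mk (Ideal.span {f, g})) (IsLocalRing.maximalIdeal A))
    apply this
    have h2 := Ideal.map_eq_top_or_isMaximal_of_surjective (Ideal.Quotient.mk (Ideal.span {f, g}))
      Ideal.Quotient.mk_surjective (IsLocalRing.maximalIdeal.isMaximal A)
    rcases h2 with h2 | h2
    · exfalso
      have h3 := congrArg (Ideal.comap (Ideal.Quotient.mk (Ideal.span {f, g}))) h2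
      rw [Ideal.comap_map_of_surjective _ Ideal.Quotient.mk_surjective, ← RingHom.ker_eq_comap_bot,
        Ideal.mk_ker, sup_eq_left.mpr hle, Ideal.comap_top] at h3
      exact (IsLocalRing.maximalIdeal.isMaximal A).ne_top h3
    · exact h2
  obtain ⟨h0, hlt⟩ := local_length _ hmax' m hm
  rw [← map_pow, Ideal.Quotient.eq_zero_iff_mem, Ideal.mem_span_pair] at h0
  obtain ⟨α, β, hαβ⟩ := h0
  have hdec : ∀ n : ℕ, (∃ a b, g = a * l ^ n + b * f) ∨
      ∃ n' < n, ∃ s b, IsUnit s ∧ g = s * l ^ n' + b * f := by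
    intro n
    induction n with
    | zero => left; exact ⟨g, 0, by simp⟩
    | succ n ih =>
      rcases ih with ⟨a, b, hab⟩ | ⟨n', hn', s, b, hs, h⟩
      · by_cases hu : IsUnit a
        · right; exact ⟨n, by omega, a, b, hu, hab⟩
        · left
          have h1 : a ∈ IsLocalRing.maximalIdeal A := hu
          rw [hmax, Ideal.mem_span_pair] at h1
          obtain ⟨a1, a2, rfl⟩ := h1
          exact ⟨a2, b + a1 * l ^ n, by rw [hab]; ring⟩
      · right; exact ⟨n', by omega, s, b, hs, h⟩
  rcases hdec (m + 1) with ⟨a, b, hab⟩ | ⟨n', hn', s, b, hs, h⟩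
  · exfalso
    have hu : IsUnit (1 - β * a * l) := by
      by_contra hn
      have h1 : (1 - β * a * l) ∈ IsLocalRing.maximalIdeal A := hn
      have h2 : β * a * l ∈ IsLocalRing.maximalIdeal A := by
        rw [hmax]; exact Ideal.mul_mem_left _ _ (Ideal.subset_span (by simp))
      have h3 := Ideal.add_mem _ h1 h2
      rw [sub_add_cancel] at h3
      exact (Ideal.ne_top_iff_one _).mp (IsLocalRing.maximalIdeal.isMaximal A).ne_top h3
    apply hl m
    rw [← Ideal.unit_mul_mem_iff_mem _ hu, Ideal.mem_span_singleton]
    exact ⟨α + β * b, by linear_combination -hαβ + β * hab⟩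
  · have hn : n' = m := by
      by_contra hne
      apply hlt n' (by omega)
      rw [← map_pow, Ideal.Quotient.eq_zero_iff_mem]
      rw [← Ideal.unit_mul_mem_iff_mem _ hs, Ideal.mem_span_pair]
      exact ⟨-b, 1, by rw [h]; ring⟩
    subst hn
    exact ⟨s, b, hs, h⟩
end localD
section geomE

theorem lineEval_homog (q : Fin 3 → K) {H : MvPolynomial (Fin 3) K} {n : ℕ}
    (hH : H.IsHomogeneous n) :
    lineEval q H = Polynomial.C (eval q H) * Polynomial.X ^ n := by
  have h1 : lineEval q H = ∑ d ∈ H.support, Polynomial.C (coeff d H) *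
      ∏ i, (Polynomial.C (q i) * Polynomial.X) ^ d i := by
    rw [lineEval, aeval_def, eval₂_eq']; rfl
  rw [h1, eval_eq', map_sum, Finset.sum_mul]
  apply Finset.sum_congr rfl
  intro d hd
  have hdeg := hH.degree_eq_sum_deg_support hd
  simp only [mul_pow, Finset.prod_mul_distrib, map_mul, map_prod, map_pow]
  rw [Finset.prod_pow_eq_pow_sum]
  have h2 : ∑ i, d i = n := by
    rw [hdeg, Finset.sum_subset (Finset.subset_univ d.support)]
    intro x _ hx; simpa using hx
  rw [h2]; ring

theorem eval_lineEval (q : Fin 3 → K) (t : K) (H : MvPolynomial (Fin 3) K) :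
    Polynomial.eval t (lineEval q H) = eval (t • q) H := by
  have h : ((Polynomial.aeval t).comp (lineEval q) : MvPolynomial (Fin 3) K →ₐ[K] K)
      = aeval (t • q) := by
    apply MvPolynomial.algHom_ext; intro i
    simp only [AlgHom.comp_apply, lineEval, aeval_X, map_mul, Polynomial.aeval_C, Polynomial.aeval_X,
      Pi.smul_apply, smul_eq_mul, Algebra.algebraMap_self, RingHom.id_apply]
    exact mul_comm _ _
  have := congrArg (fun φ => φ H) h
  simpa [Polynomial.aeval_def, MvPolynomial.aeval_def, Polynomial.eval₂_eq_eval_map] using this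

theorem eval_smul_homog (q : Fin 3 → K) (t : K) {H : MvPolynomial (Fin 3) K} {n : ℕ}
    (hH : H.IsHomogeneous n) : eval (t • q) H = t ^ n * eval q H := by
  rw [← eval_lineEval, lineEval_homog q hH, Polynomial.eval_mul, Polynomial.eval_C,
    Polynomial.eval_pow, Polynomial.eval_X, mul_comm]

theorem lin_alg (q a : Fin 3 → K) (hq : q ≠ 0) (ha : a ≠ 0) (haq : a ⬝ᵥ q = 0) :
    ∃ h e L0 L1 L2 : Fin 3 → K, a ⬝ᵥ e ≠ 0 ∧
      (∀ i j, L0 i * h j + L1 i * q j + L2 i * e j = if i = j then 1 else 0) ∧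
      L0 ⬝ᵥ q = 0 ∧ L0 ⬝ᵥ e = 0 ∧ L0 ⬝ᵥ h = 1 ∧ L2 ⬝ᵥ q = 0 := by
  obtain ⟨k, hk⟩ := Function.ne_iff.mp ha
  let e : Fin 3 → K := Pi.single k 1
  have hae : a ⬝ᵥ e ≠ 0 := by simpa [e] using hk
  have hli : LinearIndependent K ![q, e] := by
    rw [LinearIndependent.pair_iff]
    intro s t hst
    have h1 : s * (a ⬝ᵥ q) + t * (a ⬝ᵥ e) = 0 := by
      have := congrArg (fun v => a ⬝ᵥ v) hst
      simpa [dotProduct_add, dotProduct_smul] using this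
    rw [haq, mul_zero, zero_add] at h1
    have ht : t = 0 := (mul_eq_zero.mp h1).resolve_right hae
    rw [ht, zero_smul, add_zero] at hst
    exact ⟨(smul_eq_zero.mp hst).resolve_right hq, ht⟩
  have hc := crossProduct_ne_zero_iff_linearIndependent.mpr hli
  obtain ⟨j, hj⟩ := Function.ne_iff.mp hc
  let h : Fin 3 → K := Pi.single j 1
  let M : Matrix (Fin 3) (Fin 3) K := ![h, q, e]
  have hM : M.det ≠ 0 := by
    have h1 := triple_product_eq_det h q e
    have h2 : M.det = h ⬝ᵥ (crossProduct q e) := h1.symm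
    rw [h2]; simpa [h] using hj
  have hu : IsUnit M.det := isUnit_iff_ne_zero.mpr hM
  have h1 := Matrix.nonsing_inv_mul M hu
  have h2 := Matrix.mul_nonsing_inv M hu
  have h2' : ∀ i j, ∑ k, M⁻¹ k j * M i k = if i = j then 1 else 0 := by
    intro i j
    have := congrFun (congrFun h2 i) j
    rw [Matrix.mul_apply, Matrix.one_apply] at this
    rw [← this]; exact Finset.sum_congr rfl fun _ _ => mul_comm _ _
  refine ⟨h, e, fun i => M⁻¹ i 0, fun i => M⁻¹ i 1, fun i => M⁻¹ i 2, hae, ?_, ?_, ?_, ?_, ?_⟩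
  · intro i j
    have := congrFun (congrFun h1 i) j
    rw [Matrix.mul_apply, Fin.sum_univ_three, Matrix.one_apply] at this
    exact this
  · exact h2' 1 0
  · exact h2' 2 0
  · exact h2' 0 0
  · exact h2' 1 2

/-- linear form -/
noncomputable def linF (L : Fin 3 → K) : MvPolynomial (Fin 3) K := ∑ j, C (L j) * X j

theorem eval_linF (L y : Fin 3 → K) : eval y (linF L) = L ⬝ᵥ y := by
  simp [linF, dotProduct]

theorem pderiv_linF (L : Fin 3 → K) (j : Fin 3) : pderiv j (linF L) = C (L j) := by
  simp [linF, pderiv_X, Pi.single_apply]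

theorem linF_homog (L : Fin 3 → K) : (linF L).IsHomogeneous 1 :=
  IsHomogeneous.sum _ _ _ fun _ _ => isHomogeneous_C_mul_X _ _

theorem X_decomp (h q e L0 L1 L2 : Fin 3 → K)
    (H : ∀ i j, L0 i * h j + L1 i * q j + L2 i * e j = if i = j then 1 else 0) (j : Fin 3) :
    (X j : MvPolynomial (Fin 3) K) =
      C (h j) * linF L0 + C (q j) * linF L1 + C (e j) * linF L2 := by
  have h1 : C (h j) * linF L0 + C (q j) * linF L1 + C (e j) * linF L2
      = ∑ i, C (L0 i * h j + L1 i * q j + L2 i * e j) * X i := by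
    simp only [linF, Fin.sum_univ_three, map_add, map_mul]; ring
  rw [h1]
  simp [H]

theorem ker_lineEval (h q e L0 L1 L2 : Fin 3 → K)
    (H : ∀ i j, L0 i * h j + L1 i * q j + L2 i * e j = if i = j then 1 else 0)
    (p : MvPolynomial (Fin 3) K) (hp : lineEval q p = 0) :
    p ∈ Ideal.span {linF L0, linF L2} := by
  set I : Ideal (MvPolynomial (Fin 3) K) := Ideal.span {linF L0, linF L2} with hI
  have hal : (Ideal.Quotient.mkₐ K I) =
      (Ideal.Quotient.mkₐ K I).comp ((Polynomial.aeval (linF L1)).comp (lineEval q)) := by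
    ext j
    simp only [AlgHom.comp_apply, lineEval, aeval_X, map_mul, Polynomial.aeval_X,
      Polynomial.aeval_C]
    rw [← map_mul]
    change Ideal.Quotient.mk I _ = Ideal.Quotient.mk I _
    rw [Ideal.Quotient.eq, X_decomp h q e L0 L1 L2 H j, hI, Ideal.mem_span_pair]
    exact ⟨C (h j), C (e j), by rw [MvPolynomial.algebraMap_eq]; ring⟩
  have := congrArg (fun φ => φ p) hal
  simp only [AlgHom.comp_apply, hp, map_zero] at this
  exact Ideal.Quotient.eq_zero_iff_mem.mp this

/-- directional derivative at a point -/
theorem dir_mul (q e : Fin 3 → K) (A B : MvPolynomial (Fin 3) K) :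
    ∑ j, e j * eval q (pderiv j (A * B)) =
      eval q A * ∑ j, e j * eval q (pderiv j B) + eval q B * ∑ j, e j * eval q (pderiv j A) := by
  simp only [pderiv_mul, map_add, map_mul, Fin.sum_univ_three]; ring

theorem dir_linF (q e L : Fin 3 → K) :
    ∑ j, e j * eval q (pderiv j (linF L)) = L ⬝ᵥ e := by
  simp [pderiv_linF, dotProduct, mul_comm]

theorem linF_prime (L : Fin 3 → K) (hL : L ≠ 0) : Prime (linF L) := by
  obtain ⟨j, hj⟩ := Function.ne_iff.mp hL
  have hco : coeff (Finsupp.single j 1) (linF L) ≠ 0 := by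
    have h : coeff (Finsupp.single j 1) (linF L) = L j := by
      simp [linF, coeff_sum, coeff_C_mul, coeff_X, Finsupp.single_left_inj]
    rw [h]; exact hj
  have hne : linF L ≠ 0 := by
    intro h; rw [h] at hco; simp at hco
  apply Irreducible.prime
  apply irreducible_of_totalDegree_eq_one
  · exact (linF_homog L).totalDegree hne
  · intro x hx
    have := hx (Finsupp.single j 1)
    exact isUnit_iff_ne_zero.mpr fun h0 => hco (zero_dvd_iff.mp (h0 ▸ this))
end geomE
section geomF

theorem lineEval_ne_of_eval (q : Fin 3 → K) (p : MvPolynomial (Fin 3) K) (h : eval q p ≠ 0) :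
    lineEval q p ≠ 0 := by
  intro h0
  have := eval_lineEval q 1 p
  rw [h0, one_smul, Polynomial.eval_zero] at this
  exact h this.symm

theorem poly_identity (f g : MvPolynomial (Fin 3) K) (h q e L0 L1 L2 : Fin 3 → K)
    (hae : ∑ j, e j * eval q (pderiv j f) ≠ 0)
    (H : ∀ i j, L0 i * h j + L1 i * q j + L2 i * e j = if i = j then 1 else 0)
    (h0q : L0 ⬝ᵥ q = 0) (h0e : L0 ⬝ᵥ e = 0) (h0h : L0 ⬝ᵥ h = 1) (h2q : L2 ⬝ᵥ q = 0)
    (hfq : lineEval q f = 0) (hgq : lineEval q g = 0) (m : ℕ)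
    (hm : interMult f g q = (m : ℕ∞)) :
    ∃ c s b, lineEval q c ≠ 0 ∧ lineEval q s ≠ 0 ∧ c * g = s * linF L0 ^ m + b * f := by
  have hL0 : L0 ≠ 0 := by
    rintro rfl; simp at h0h
  have hl0 : lineEval q (linF L0) = 0 := by
    rw [lineEval_homog q (linF_homog L0), eval_linF, h0q]; simp
  have hl2 : lineEval q (linF L2) = 0 := by
    rw [lineEval_homog q (linF_homog L2), eval_linF, h2q]; simp
  have hfeq := ker_lineEval h q e L0 L1 L2 H f hfq
  obtain ⟨β, α, hαβ⟩ := Ideal.mem_span_pair.mp hfeq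
  have hα : lineEval q α ≠ 0 := by
    apply lineEval_ne_of_eval
    intro hα
    apply hae
    rw [← hαβ]
    simp only [map_add, mul_add, Finset.sum_add_distrib]
    rw [dir_mul, dir_mul, dir_linF, dir_linF, eval_linF, eval_linF, h0e, h0q, h2q, hα]
    ring
  have hndvd : ¬ linF L0 ∣ f := by
    rintro ⟨w, hw⟩
    apply hae
    rw [hw, dir_mul, dir_linF, eval_linF, h0e, h0q]; ring
  let I : Ideal (MvPolynomial (Fin 3) K) := RingHom.ker (lineEval q)
  have hI : I.IsPrime := RingHom.ker_isPrime _
  have heq : lineCompl q = I.primeCompl := by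
    ext x; rfl
  have hloc : IsLocalization.AtPrime (Localization (lineCompl q)) I := by
    unfold IsLocalization.AtPrime
    rw [← heq]; infer_instance
  have hlr : IsLocalRing (Localization (lineCompl q)) :=
    IsLocalization.AtPrime.isLocalRing (Localization (lineCompl q)) I
  set A := Localization (lineCompl q) with hA
  set φ := algebraMap (MvPolynomial (Fin 3) K) A with hφ
  have hIs : I = Ideal.span {linF L0, linF L2} := by
    apply le_antisymm
    · intro p hp; exact ker_lineEval h q e L0 L1 L2 H p hp
    · rw [Ideal.span_le]; rintro x (rfl | rfl)
      · exact hl0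
      · exact hl2
  have hunit : ∀ x, lineEval q x ≠ 0 → IsUnit (φ x) := fun x hx =>
    IsLocalization.map_units A (⟨x, hx⟩ : lineCompl q)
  have hmap : Ideal.map φ I = IsLocalRing.maximalIdeal A :=
    IsLocalization.AtPrime.map_eq_maximalIdeal I A
  have hmax : IsLocalRing.maximalIdeal A = Ideal.span {φ f, φ (linF L0)} := by
    rw [← hmap]
    apply le_antisymm
    · rw [hIs, Ideal.map_span, Ideal.span_le]
      rintro x ⟨y, hy | hy, rfl⟩
      · rw [hy]; exact Ideal.subset_span (by simp)
      · rw [Set.mem_singleton_iff] at hy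
        rw [hy]
        obtain ⟨w, hw⟩ := (hunit α hα).exists_right_inv
        change φ (linF L2) ∈ _
        rw [SetLike.mem_coe, Ideal.mem_span_pair]
        refine ⟨w, - w * φ β, ?_⟩
        rw [← hαβ, map_add, map_mul, map_mul]
        linear_combination (φ (linF L2)) * hw
    · rw [Ideal.span_le]
      rintro x (rfl | rfl)
      · exact Ideal.mem_map_of_mem φ hfq
      · exact Ideal.mem_map_of_mem φ hl0
  have hgm : φ g ∈ IsLocalRing.maximalIdeal A := by
    rw [← hmap]; exact Ideal.mem_map_of_mem φ hgq
  have hinj : Function.Injective φ := by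
    apply IsLocalization.injective A (M := lineCompl q)
    intro x hx
    apply mem_nonZeroDivisors_of_ne_zero
    rintro rfl
    exact hx (map_zero _)
  have hlk : ∀ k : ℕ, φ (linF L0) ^ k ∉ Ideal.span {φ f} := by
    intro k hk
    obtain ⟨y, hy⟩ := Ideal.mem_span_singleton'.mp hk
    obtain ⟨⟨n, c⟩, hc⟩ := IsLocalization.surj (lineCompl q) y
    simp only at hc
    have h1 : φ (n * f) = φ (c * linF L0 ^ k) := by
      rw [map_mul, map_mul, map_pow, ← hc, ← hy]; ring
    have h2 := hinj h1
    clear h1 hc hy hk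
    induction k generalizing n with
    | zero =>
      apply c.2
      change lineEval q _ = 0
      have := congrArg (lineEval q) h2
      rw [map_mul, hfq] at this
      simpa using this.symm
    | succ k ih =>
      have hd : linF L0 ∣ n * f := by rw [h2, pow_succ]; exact ⟨c * linF L0 ^ k, by ring⟩
      rcases (linF_prime L0 hL0).dvd_or_dvd hd with hd | hd
      · obtain ⟨n', rfl⟩ := hd
        apply ih n'
        apply mul_left_cancel₀ (linF_prime L0 hL0).ne_zero
        rw [← mul_assoc, h2]; ring
      · exact hndvd hd
  obtain ⟨s, b, hs, hgs⟩ := local_main (φ f) (φ g) (φ (linF L0)) hmax hgm hlk m hm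
  obtain ⟨⟨s1, c1⟩, hc1⟩ := IsLocalization.surj (lineCompl q) s
  obtain ⟨⟨b1, c2⟩, hc2⟩ := IsLocalization.surj (lineCompl q) b
  simp only at hc1 hc2
  have hs1 : lineEval q s1 ≠ 0 := by
    intro hs1
    have h1 : φ s1 ∈ IsLocalRing.maximalIdeal A := by
      rw [← hmap]; exact Ideal.mem_map_of_mem φ hs1
    have h2 : IsUnit (φ s1) := by
      rw [hφ, ← hc1]; exact hs.mul (IsLocalization.map_units A c1)
    exact (IsLocalRing.mem_maximalIdeal _).mp h1 h2
  refine ⟨c1 * c2, s1 * c2, b1 * c1, ?_, ?_, ?_⟩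
  · rw [map_mul]; exact mul_ne_zero c1.2 c2.2
  · rw [map_mul]; exact mul_ne_zero hs1 c2.2
  · apply hinj
    simp only [map_mul, map_add, map_pow]
    rw [← hφ] at hc1 hc2
    rw [← hc1, ← hc2, hgs]
    ring

/-- rescaling the point -/
theorem poly_identity_rescale [CharZero K] (f g l : MvPolynomial (Fin 3) K) {d n k : ℕ}
    (hf : f.IsHomogeneous d) (hg : g.IsHomogeneous n) (hl : l.IsHomogeneous k)
    (q : Fin 3 → K) (m : ℕ)
    (c s b : MvPolynomial (Fin 3) K) (hc : lineEval q c ≠ 0) (hs : lineEval q s ≠ 0)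
    (hid : c * g = s * l ^ m + b * f) (lam : K) (hlam : lam ≠ 0) :
    ∃ c s b : MvPolynomial (Fin 3) K, eval (lam • q) c ≠ 0 ∧ eval (lam • q) s ≠ 0 ∧
      c * g = s * l ^ m + b * f := by
  obtain ⟨t, ht⟩ : ∃ t, Polynomial.eval t (lineEval q c * lineEval q s * Polynomial.X) ≠ 0 := by
    by_contra hcon
    push Not at hcon
    have := Polynomial.funext (p := lineEval q c * lineEval q s * Polynomial.X) (q := 0)
      (fun r => by rw [hcon r, Polynomial.eval_zero])
    simp [hc, hs] at this
  simp only [Polynomial.eval_mul, Polynomial.eval_X, eval_lineEval] at ht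
  have ht0 : t ≠ 0 := right_ne_zero_of_mul ht
  have hct : eval (t • q) c ≠ 0 := left_ne_zero_of_mul (left_ne_zero_of_mul ht)
  have hst : eval (t • q) s ≠ 0 := right_ne_zero_of_mul (left_ne_zero_of_mul ht)
  let μ : K := t / lam
  have hμ : μ ≠ 0 := div_ne_zero ht0 hlam
  let ψ : MvPolynomial (Fin 3) K →ₐ[K] MvPolynomial (Fin 3) K := aeval fun i => C μ * X i
  have hψ : ∀ {H : MvPolynomial (Fin 3) K} {n : ℕ}, H.IsHomogeneous n → ψ H = C (μ ^ n) * H := by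
    intro H n hH
    apply MvPolynomial.funext
    intro y
    have h1 : ∀ H, eval y (ψ H) = eval (μ • y) H := by
      intro H
      have : (aeval y : _ →ₐ[K] K).comp ψ = aeval (μ • y) := by
        apply MvPolynomial.algHom_ext; intro i; simp [ψ]
      have := congrArg (fun φ => φ H) this
      simpa [MvPolynomial.aeval_eq_eval] using this
    rw [h1, eval_smul_homog y μ hH, map_mul, eval_C]
  have hev : ∀ H, eval (lam • q) (ψ H) = eval (t • q) H := by
    intro H
    have : (aeval (lam • q) : _ →ₐ[K] K).comp ψ = aeval (t • q) := by
      apply MvPolynomial.algHom_ext; intro i; simp [ψ, μ]; field_simp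
    have := congrArg (fun φ => φ H) this
    simpa [MvPolynomial.aeval_eq_eval] using this
  refine ⟨ψ c * C (μ ^ n), ψ s * C (μ ^ (k * m)), ψ b * C (μ ^ d), ?_, ?_, ?_⟩
  · rw [map_mul, hev, eval_C]; exact mul_ne_zero hct (pow_ne_zero _ hμ)
  · rw [map_mul, hev, eval_C]; exact mul_ne_zero hst (pow_ne_zero _ hμ)
  · have := congrArg ψ hid
    rw [map_mul, map_add, map_mul, map_mul, map_pow, hψ hg, hψ hf, hψ hl] at this
    rw [mul_assoc, this]
    simp only [map_pow]
    ring
end geomF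
section geomG

theorem deriv_at {σ : Type*} [Fintype σ] (Q : σ → K) (D : MvPolynomial σ K →ₗ[K] K)
    (hmul : ∀ A B, D (A * B) = eval Q A * D B + eval Q B * D A) (H : MvPolynomial σ K) :
    D H = ∑ i, D (X i) * eval Q (pderiv i H) := by
  classical
  have h1 : D 1 = 0 := by
    have := hmul 1 1
    simp only [mul_one, map_one, one_mul] at this
    simpa using this
  induction H using MvPolynomial.induction_on with
  | C a =>
    have : (C a : MvPolynomial σ K) = a • 1 := by rw [smul_eq_C_mul, mul_one]
    simp only [pderiv_C, map_zero, mul_zero, Finset.sum_const_zero]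
    rw [this, map_smul, h1, smul_zero]
  | add p q hp hq =>
    simp only [map_add, hp, hq, mul_add, Finset.sum_add_distrib]
  | mul_X p i hp =>
    rw [hmul, hp]
    simp only [pderiv_mul, map_add, map_mul, mul_add, Finset.sum_add_distrib, pderiv_X, eval_X]
    have e1 : ∑ x, D (X x) * (eval Q p * eval Q ((Pi.single x 1 : σ → MvPolynomial σ K) i))
        = eval Q p * D (X i) := by
      rw [Finset.sum_eq_single i]
      · simp [mul_comm]
      · intro b _ hb; simp [Pi.single_apply, hb.symm]
      · simp
    rw [Finset.mul_sum, add_comm]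
    congr 1
    · exact Finset.sum_congr rfl fun _ _ => by ring
    · rw [← e1]

/-- line through the origin in 4-space -/
noncomputable def line4 (P : Fin 4 → K) : MvPolynomial (Fin 4) K →ₐ[K] Polynomial K :=
  aeval fun i => Polynomial.C (P i) * Polynomial.X

theorem eval_line4 (q : Fin 4 → K) (t : K) (H : MvPolynomial (Fin 4) K) :
    Polynomial.eval t (line4 q H) = eval (t • q) H := by
  have h : ((Polynomial.aeval t).comp (line4 q) : MvPolynomial (Fin 4) K →ₐ[K] K)
      = aeval (t • q) := by
    apply MvPolynomial.algHom_ext; intro i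
    simp only [AlgHom.comp_apply, line4, aeval_X, map_mul, Polynomial.aeval_C, Polynomial.aeval_X,
      Pi.smul_apply, smul_eq_mul, Algebra.algebraMap_self, RingHom.id_apply]
    exact mul_comm _ _
  have := congrArg (fun φ => φ H) h
  simpa [Polynomial.aeval_def, MvPolynomial.aeval_def, Polynomial.eval₂_eq_eval_map] using this

theorem line4_deriv [CharZero K] (P : Fin 4 → K) (W : MvPolynomial (Fin 4) K)
    (hW : ∀ t : K, t ≠ 0 → eval (t • P) W = 0) (lam : K) :
    ∑ i, P i * eval (lam • P) (pderiv i W) = 0 := by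
  have h0 : line4 P W = 0 := by
    have h1 : line4 P W * Polynomial.X = 0 := by
      apply Polynomial.funext
      intro t
      rw [Polynomial.eval_mul, eval_line4, Polynomial.eval_X, Polynomial.eval_zero]
      by_cases ht : t = 0
      · rw [ht, mul_zero]
      · rw [hW t ht, zero_mul]
    simpa using h1
  let D : MvPolynomial (Fin 4) K →ₗ[K] K :=
    (Polynomial.leval lam).comp (Polynomial.derivative.comp (line4 P).toLinearMap)
  have hD : ∀ H, D H = Polynomial.eval lam (Polynomial.derivative (line4 P H)) := fun H => rfl
  have := deriv_at (lam • P) D (by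
    intro A B
    simp only [hD, map_mul, Polynomial.derivative_mul, Polynomial.eval_add, Polynomial.eval_mul,
      eval_line4]
    ring) W
  rw [hD, h0] at this
  have hX : ∀ i, D (X i) = P i := by
    intro i; rw [hD]; simp [line4]
  simp only [hX] at this
  rw [← this]; simp

theorem pderiv_zero_rename (c : MvPolynomial (Fin 3) K) :
    pderiv (0 : Fin 4) (rename Fin.succ c) = 0 := by
  induction c using MvPolynomial.induction_on with
  | C a => simp
  | add p q hp hq => simp [hp, hq]
  | mul_X p i hp => simp [hp, pderiv_mul, pderiv_X, Pi.single_apply, Fin.succ_ne_zero]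

theorem W_vanish (f g c s b : MvPolynomial (Fin 3) K) {d m : ℕ} (hd : 3 ≤ d) (hm0 : m ≠ 0)
    (hf : f.IsHomogeneous (d - 1)) (hg : g.IsHomogeneous d) (L0 q e : Fin 3 → K) (p0 : K)
    (hae : ∑ j, e j * eval q (pderiv j f) ≠ 0)
    (h0q : L0 ⬝ᵥ q = 0) (h0e : L0 ⬝ᵥ e = 0)
    (hfq : eval q f = 0) (hgq : eval q g = 0)
    (hgr : ∀ j, p0 * eval q (pderiv j f) + eval q (pderiv j g) = 0)
    (hid : c * g = s * linF L0 ^ m + b * f) (t : K) (ht : t ≠ 0) :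
    t * p0 * eval (t • q) c + eval (t • q) b = 0 := by
  have h1 : ∑ j, e j * eval (t • q) (pderiv j (c * g)) =
      ∑ j, e j * eval (t • q) (pderiv j (s * linF L0 ^ m + b * f)) := by rw [hid]
  have hl : eval (t • q) (linF L0) = 0 := by
    rw [eval_linF, dotProduct_smul, h0q, smul_zero]
  obtain ⟨k, rfl⟩ := Nat.exists_eq_succ_of_ne_zero hm0
  simp only [map_add, mul_add, Finset.sum_add_distrib] at h1
  rw [dir_mul, dir_mul, dir_mul, pow_succ, dir_mul, dir_linF, h0e, map_mul, hl,
    eval_smul_homog q t hf, eval_smul_homog q t hg, hfq, hgq] at h1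
  have h2 : ∑ j, e j * eval (t • q) (pderiv j f) =
      t ^ (d - 1 - 1) * ∑ j, e j * eval q (pderiv j f) := by
    rw [Finset.mul_sum]
    refine Finset.sum_congr rfl fun j _ => ?_
    rw [eval_smul_homog q t hf.pderiv]; ring
  have h3 : ∑ j, e j * eval (t • q) (pderiv j g) =
      - (t ^ (d - 1 - 1) * t * p0 * ∑ j, e j * eval q (pderiv j f)) := by
    rw [Finset.mul_sum, ← Finset.sum_neg_distrib]
    refine Finset.sum_congr rfl fun j _ => ?_
    rw [eval_smul_homog q t hg.pderiv, eq_neg_of_add_eq_zero_right (hgr j),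
      ← pow_succ, show d - 1 - 1 + 1 = d - 1 by omega]; ring
  rw [h2, h3] at h1
  have h4 : (t * p0 * eval (t • q) c + eval (t • q) b) *
      (t ^ (d - 1 - 1) * ∑ j, e j * eval q (pderiv j f)) = 0 := by
    linear_combination - h1
  exact (mul_eq_zero.mp h4).resolve_right (mul_ne_zero (pow_ne_zero _ ht) hae)

/-- localization map into power series -/
noncomputable def locHom (P : Fin 4 → K) (r : Fin 4) :
    MvPolynomial (Fin 4) K →ₐ[K] MvPowerSeries (Fin 3) K :=
  (MvPolynomial.coeToMvPowerSeries.algHom K).comp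
    (aeval (r.succAboveCases (1 : MvPolynomial (Fin 3) K)
    (fun j => C (P (r.succAbove j) / P r) + X j)))

theorem locHom_apply (P : Fin 4 → K) (r : Fin 4) (F : MvPolynomial (Fin 4) K) :
    locHom P r F = (localEq F P r : MvPowerSeries (Fin 3) K) := by
  simp [locHom, localEq]

theorem locHom_const (P : Fin 4 → K) (r : Fin 4) (hr : P r ≠ 0) (F : MvPolynomial (Fin 4) K) :
    MvPowerSeries.constantCoeff (locHom P r F) = eval ((P r)⁻¹ • P) F := by
  have h : ((MvPowerSeries.constantCoeff (σ := Fin 3) (R := K)).comp (locHom P r).toRingHom)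
      = eval ((P r)⁻¹ • P) := by
    apply MvPolynomial.ringHom_ext
    · intro a; simp [locHom, MvPowerSeries.algebraMap_apply]
    · intro i
      cases i using r.succAboveCases
      · simp [locHom, hr]
      · simp [locHom, div_eq_inv_mul]
  exact congrArg (fun φ => φ F) h

theorem coeff_one_mul (j : Fin 3) (a b : MvPowerSeries (Fin 3) K) :
    MvPowerSeries.coeff (Finsupp.single j 1) (a * b) =
      MvPowerSeries.constantCoeff a * MvPowerSeries.coeff (Finsupp.single j 1) b +
      MvPowerSeries.constantCoeff b * MvPowerSeries.coeff (Finsupp.single j 1) a := by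
  classical
  rw [MvPowerSeries.coeff_mul, Finsupp.antidiagonal_single, Finset.sum_map]
  simp [Finset.Nat.antidiagonal_succ]
  ring

theorem locHom_coeff (P : Fin 4 → K) (r : Fin 4) (hr : P r ≠ 0) (j : Fin 3)
    (F : MvPolynomial (Fin 4) K) :
    MvPowerSeries.coeff (Finsupp.single j 1) (locHom P r F) =
      eval ((P r)⁻¹ • P) (pderiv (r.succAbove j) F) := by
  classical
  let D : MvPolynomial (Fin 4) K →ₗ[K] K :=
    (MvPowerSeries.coeff (Finsupp.single j 1)).comp (locHom P r).toLinearMap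
  have hD : ∀ H, D H = MvPowerSeries.coeff (Finsupp.single j 1) (locHom P r H) := fun H => rfl
  have h := deriv_at ((P r)⁻¹ • P) D (by
    intro A B
    rw [hD, map_mul, coeff_one_mul, locHom_const P r hr, locHom_const P r hr]; rfl) F
  rw [← hD, h, Fin.sum_univ_succAbove _ r]
  have h0 : D (X r) = 0 := by
    rw [hD]; simp [locHom, MvPowerSeries.coeff_one]
  have h1 : ∀ k, D (X (r.succAbove k)) = if k = j then 1 else 0 := by
    intro k
    rw [hD]; simp [locHom, MvPowerSeries.coeff_C, MvPowerSeries.coeff_X, Finsupp.single_left_inj, eq_comm]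
  simp [h0, h1]
end geomG
section geomH

theorem sum_extend (r : Fin 4) (y : Fin 3 → K) (v : Fin 4 → K) :
    ∑ i, (r.succAboveCases (0 : K) y : Fin 4 → K) i * v i = ∑ j, v (r.succAbove j) * y j := by
  rw [Fin.sum_univ_succAbove _ r]
  simp [mul_comm]

theorem final_step [CharZero K] [IsAlgClosed K] (f g c s b : MvPolynomial (Fin 3) K)
    {d m : ℕ} (hm0 : m ≠ 0)
    (hf : f.IsHomogeneous (d - 1)) (P : Fin 4 → K) (h e L0 L1 L2 : Fin 3 → K)
    (hae : ∑ j, e j * eval (P ∘ Fin.succ) (pderiv j f) ≠ 0)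
    (haq : ∑ j, P (Fin.succ j) * eval (P ∘ Fin.succ) (pderiv j f) = 0)
    (H : ∀ i j, L0 i * h j + L1 i * P (Fin.succ j) + L2 i * e j = if i = j then 1 else 0)
    (h0q : L0 ⬝ᵥ (P ∘ Fin.succ) = 0)
    (hfq : eval (P ∘ Fin.succ) f = 0)
    (r : Fin 4) (hr : P r ≠ 0)
    (hc : eval ((P r)⁻¹ • (P ∘ Fin.succ)) c ≠ 0) (hs : eval ((P r)⁻¹ • (P ∘ Fin.succ)) s ≠ 0)
    (hid : c * g = s * linF L0 ^ m + b * f)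
    (hW : ∀ t : K, t ≠ 0 →
      t * P 0 * eval (t • (P ∘ Fin.succ)) c + eval (t • (P ∘ Fin.succ)) b = 0) :
    ∃ E : MvPowerSeries (Fin 3) K ≃ₐ[K] MvPowerSeries (Fin 3) K,
      E (locHom P r (X 0 * rename Fin.succ f + rename Fin.succ g)) =
      (MvPowerSeries.X 0) ^ 2 + (MvPowerSeries.X 1) ^ 2 + (MvPowerSeries.X 2) ^ m := by
  set q := P ∘ Fin.succ with hq
  set lam := (P r)⁻¹ with hlam
  have hlam0 : lam ≠ 0 := inv_ne_zero hr
  set W : MvPolynomial (Fin 4) K := X 0 * rename Fin.succ c + rename Fin.succ b with hWdef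
  have hev : ∀ (t : K) (p : MvPolynomial (Fin 3) K),
      eval (t • P) (rename Fin.succ p) = eval (t • q) p := by
    intro t p; rw [eval_rename]; rfl
  have hW4 : ∀ t : K, t ≠ 0 → eval (t • P) W = 0 := by
    intro t ht
    rw [hWdef, map_add, map_mul, eval_X, hev, hev]
    exact hW t ht
  have hdW := line4_deriv P W hW4 lam
  set φ := locHom P r with hφ
  have hconst : ∀ F, MvPowerSeries.constantCoeff (φ F) = eval (lam • P) F :=
    fun F => locHom_const P r hr F
  have hcoeff : ∀ F j, MvPowerSeries.coeff (Finsupp.single j 1) (φ F) =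
      eval (lam • P) (pderiv (r.succAbove j) F) := fun F j => locHom_coeff P r hr j F
  set c' := φ (rename Fin.succ c) with hc'
  have hcc : MvPowerSeries.constantCoeff c' ≠ 0 := by rw [hc', hconst, hev]; exact hc
  have hcinv : c' * c'⁻¹ = 1 := MvPowerSeries.mul_inv_cancel c' hcc
  have hcinv0 : MvPowerSeries.constantCoeff c'⁻¹ ≠ 0 := by
    rw [MvPowerSeries.constantCoeff_inv]; exact inv_ne_zero hcc
  let u : Fin 3 → MvPowerSeries (Fin 3) K :=
    ![φ (rename Fin.succ f), c'⁻¹ * φ W, φ (rename Fin.succ (linF L0))]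
  have hu0 : u 0 = φ (rename Fin.succ f) := rfl
  have hu1 : u 1 = c'⁻¹ * φ W := rfl
  have hu2 : u 2 = φ (rename Fin.succ (linF L0)) := rfl
  have hW0 : MvPowerSeries.constantCoeff (φ W) = 0 := by rw [hconst]; exact hW4 lam hlam0
  have hG : φ (X 0 * rename Fin.succ f + rename Fin.succ g) =
      u 0 * u 1 + (φ (rename Fin.succ s) * c'⁻¹) * u 2 ^ m := by
    have h1 := congrArg (fun p => φ (rename Fin.succ p)) hid
    simp only [map_mul, map_add, map_pow] at h1
    rw [hu0, hu1, hu2, hWdef]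
    simp only [map_mul, map_add]
    rw [← hc'] at h1 ⊢
    linear_combination c'⁻¹ * h1 - (φ (X 0) * φ (rename Fin.succ f) + φ (rename Fin.succ g)) * hcinv
  rw [hG]
  let J : Matrix (Fin 3) (Fin 3) K := fun i j => MvPowerSeries.coeff (Finsupp.single j 1) (u i)
  refine MvPowerSeries.formal_normal_form u _ ?_ ?_ J (fun i j => rfl) ?_ m hm0
  · rw [map_mul, hconst, hev]
    exact mul_ne_zero hs hcinv0
  · intro i
    fin_cases i
    · change MvPowerSeries.constantCoeff (u 0) = 0
      rw [hu0, hconst, hev, eval_smul_homog q lam hf, hfq, mul_zero]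
    · change MvPowerSeries.constantCoeff (u 1) = 0
      rw [hu1, map_mul, hW0, mul_zero]
    · change MvPowerSeries.constantCoeff (u 2) = 0
      rw [hu2, hconst, hev, eval_linF, dotProduct_smul, h0q, smul_zero]
  · rw [isUnit_iff_ne_zero]
    intro hdet
    obtain ⟨y, hy0, hy⟩ := Matrix.exists_mulVec_eq_zero_iff.mpr hdet
    apply hy0
    let Y : Fin 4 → K := r.succAboveCases (0 : K) y
    have hYr : Y r = 0 := by simp [Y]
    have hYs : ∀ j, Y (r.succAbove j) = y j := by intro j; simp [Y]
    have hsum : ∀ F, ∑ j, MvPowerSeries.coeff (Finsupp.single j 1) (φ F) * y j =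
        ∑ i, Y i * eval (lam • P) (pderiv i F) := by
      intro F
      simp only [hcoeff]
      exact (sum_extend r y fun i => eval (lam • P) (pderiv i F)).symm
    have hrow : ∀ i, ∑ j, MvPowerSeries.coeff (Finsupp.single j 1) (u i) * y j = 0 :=
      fun i => congrFun hy i
    have hpd : ∀ (p : MvPolynomial (Fin 3) K) (j : Fin 3),
        pderiv (Fin.succ j) (rename Fin.succ p) = rename Fin.succ (pderiv j p) :=
      fun p j => pderiv_rename (Fin.succ_injective _) _ _
    -- row 0
    have r0 : ∑ j : Fin 3, Y j.succ * eval q (pderiv j f) = 0 := by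
      have h1 := hrow 0
      rw [hu0, hsum, Fin.sum_univ_succ] at h1
      simp only [pderiv_zero_rename, hpd, hev, map_zero, mul_zero, zero_add,
        eval_smul_homog q lam hf.pderiv] at h1
      have h2 : lam ^ (d - 1 - 1) * ∑ j : Fin 3, Y j.succ * eval q (pderiv j f) = 0 := by
        rw [← h1, Finset.mul_sum]
        exact Finset.sum_congr rfl fun _ _ => by ring
      exact (mul_eq_zero.mp h2).resolve_left (pow_ne_zero _ hlam0)
    have r2 : ∑ j : Fin 3, L0 j * Y j.succ = 0 := by
      have h1 := hrow 2
      rw [hu2, hsum, Fin.sum_univ_succ] at h1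
      simp only [pderiv_zero_rename, hpd, hev, map_zero, mul_zero, zero_add, pderiv_linF,
        eval_C] at h1
      rw [← h1]
      exact Finset.sum_congr rfl fun _ _ => by ring
    have r1 : ∑ i, Y i * eval (lam • P) (pderiv i W) = 0 := by
      have h1 := hrow 1
      simp only [hu1, coeff_one_mul, hW0, zero_mul, add_zero, mul_assoc] at h1
      rw [← Finset.mul_sum, hsum] at h1
      exact (mul_eq_zero.mp h1).resolve_left hcinv0
    have hdec : ∀ j : Fin 3, Y j.succ = (∑ i : Fin 3, L0 i * Y i.succ) * h j +
        (∑ i : Fin 3, L1 i * Y i.succ) * P j.succ + (∑ i : Fin 3, L2 i * Y i.succ) * e j := by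
      intro j
      have h1 : Y j.succ = ∑ i : Fin 3, (L0 i * h j + L1 i * P j.succ + L2 i * e j) * Y i.succ := by
        simp [H]
      rw [h1]
      simp only [Finset.sum_mul, ← Finset.sum_add_distrib]
      exact Finset.sum_congr rfl fun _ _ => by ring
    set μ := ∑ i : Fin 3, L1 i * Y i.succ with hμ
    set ν := ∑ i : Fin 3, L2 i * Y i.succ with hν
    simp only [r2, zero_mul, zero_add] at hdec
    have hν0 : ν = 0 := by
      have h1 : μ * ∑ j : Fin 3, P j.succ * eval q (pderiv j f) +
          ν * ∑ j : Fin 3, e j * eval q (pderiv j f) = 0 := by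
        rw [← r0, Finset.mul_sum, Finset.mul_sum, ← Finset.sum_add_distrib]
        exact Finset.sum_congr rfl fun j _ => by rw [hdec j]; ring
      rw [haq, mul_zero, zero_add] at h1
      exact (mul_eq_zero.mp h1).resolve_right hae
    simp only [hν0, zero_mul, add_zero] at hdec
    have h0 : pderiv (0 : Fin 4) W = rename Fin.succ c := by
      rw [hWdef, map_add, pderiv_mul, pderiv_zero_rename, pderiv_zero_rename, pderiv_X]
      simp
    have hY0 : Y 0 = μ * P 0 := by
      have h1 : ∑ i, (Y i - μ * P i) * eval (lam • P) (pderiv i W) = 0 := by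
        have : ∑ i, (Y i - μ * P i) * eval (lam • P) (pderiv i W) =
          ∑ i, Y i * eval (lam • P) (pderiv i W)
            - μ * ∑ i, P i * eval (lam • P) (pderiv i W) := by
          rw [Finset.mul_sum, ← Finset.sum_sub_distrib]
          exact Finset.sum_congr rfl fun _ _ => by ring
        rw [this, r1, hdW]; ring
      rw [Fin.sum_univ_succ, h0, hev] at h1
      simp only [hdec, sub_self, zero_mul, Finset.sum_const_zero, add_zero] at h1
      exact sub_eq_zero.mp ((mul_eq_zero.mp h1).resolve_right hc)
    have hY : ∀ i, Y i = μ * P i := by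
      intro i
      cases i using Fin.cases with
      | zero => exact hY0
      | succ j => exact hdec j
    have hμ0 : μ = 0 := by
      have := hY r
      rw [hYr] at this
      exact (mul_eq_zero.mp this.symm).resolve_right hr
    funext j
    rw [← hYs j, hY, hμ0, zero_mul]; rfl
end geomH

/-- a singular point `P ≠ (1:0:0:0)` of a normalized non-degenerate monoid
surface with `I_{(p₁:p₂:p₃)}(f_{d-1}, f_d) = m` is an `A_{m-1}` singularity: in any affine
chart containing `P` the local equation is right equivalent to `x² + y² + z^m`, and its
Milnor number is `m - 1`. -/
theorem stmt7 [CharZero K] [IsAlgClosed K] {d m : ℕ} (hd : 3 ≤ d)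
    (f g : MvPolynomial (Fin 3) K)
    (hf : f.IsHomogeneous (d - 1)) (hg : g.IsHomogeneous d) (hf0 : f ≠ 0) (hg0 : g ≠ 0)
    (hgcd : ∀ q : MvPolynomial (Fin 3) K, q ∣ f → q ∣ g → IsUnit q)
    (hnocsing : ∀ b : Fin 3 → K, b ≠ 0 →
      ¬((eval b f = 0 ∧ ∀ j, eval b (pderiv j f) = 0) ∧
        (eval b g = 0 ∧ ∀ j, eval b (pderiv j g) = 0)))
    (P : Fin 4 → K) (hPO : (P ∘ Fin.succ) ≠ 0)
    (hsing : SingularAt (X 0 * rename Fin.succ f + rename Fin.succ g) P)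
    (hm : interMult f g (P ∘ Fin.succ) = (m : ℕ∞)) :
    ∀ r : Fin 4, P r ≠ 0 →
      IsATypeSing (localEq (X 0 * rename Fin.succ f + rename Fin.succ g) P r) (m - 1) ∧
      milnorNumber (localEq (X 0 * rename Fin.succ f + rename Fin.succ g) P r) = m - 1 := by
  intro r hr
  set q := P ∘ Fin.succ with hq
  obtain ⟨hF0, hFd⟩ := hsing
  have hfq : eval q f = 0 := by
    have h0 := hFd 0
    rw [map_add, pderiv_mul, pderiv_zero_rename, pderiv_zero_rename, pderiv_X] at h0
    simpa [eval_rename] using h0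
  have hgq : eval q g = 0 := by
    simp only [map_add, map_mul, eval_rename, ← hq, hfq] at hF0
    simpa using hF0
  have hgr : ∀ j, P 0 * eval q (pderiv j f) + eval q (pderiv j g) = 0 := by
    intro j
    have h0 := hFd j.succ
    rw [map_add, pderiv_mul, pderiv_rename (Fin.succ_injective _),
      pderiv_rename (Fin.succ_injective _), pderiv_X_of_ne (Fin.succ_ne_zero j).symm] at h0
    simpa [eval_rename] using h0
  let a : Fin 3 → K := fun j => eval q (pderiv j f)
  have ha : a ≠ 0 := by
    intro ha
    have ha' : ∀ j, eval q (pderiv j f) = 0 := fun j => congrFun ha j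
    refine hnocsing q hPO ⟨⟨hfq, ha'⟩, hgq, fun j => ?_⟩
    have := hgr j
    rwa [ha' j, mul_zero, zero_add] at this
  have hEuler : ∑ j, q j * eval q (pderiv j f) = 0 := by
    have h1 := congrArg (eval q) hf.sum_X_mul_pderiv
    simpa [hfq] using h1
  have haq : a ⬝ᵥ q = 0 := by
    rw [← hEuler]
    exact Finset.sum_congr rfl fun _ _ => mul_comm _ _
  obtain ⟨h, e, L0, L1, L2, hae, H, h0q, h0e, h0h, h2q⟩ := lin_alg q a hPO ha haq
  have hae' : ∑ j, e j * eval q (pderiv j f) ≠ 0 := by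
    intro h1
    apply hae
    rw [← h1]
    exact Finset.sum_congr rfl fun _ _ => mul_comm _ _
  have hlf : lineEval q f = 0 := by rw [lineEval_homog q hf, hfq]; simp
  have hlg : lineEval q g = 0 := by rw [lineEval_homog q hg, hgq]; simp
  obtain ⟨c1, s1, b1, hc1, hs1, hid1⟩ :=
    poly_identity f g h q e L0 L1 L2 hae' H h0q h0e h0h h2q hlf hlg m hm
  obtain ⟨c, s, b, hc, hs, hid⟩ := poly_identity_rescale f g (linF L0) hf hg (linF_homog L0) q m
    c1 s1 b1 hc1 hs1 hid1 (P r)⁻¹ (inv_ne_zero hr)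
  have hm0 : m ≠ 0 := by
    rintro rfl
    apply hs
    have h1 := congrArg (eval ((P r)⁻¹ • q)) hid
    rw [map_mul, map_add, map_mul, map_mul, eval_smul_homog q _ hf, eval_smul_homog q _ hg,
      hfq, hgq] at h1
    simpa using h1.symm
  have hW := W_vanish f g c s b hd hm0 hf hg L0 q e (P 0) hae' h0q h0e hfq hgq hgr hid
  obtain ⟨E, hE⟩ := final_step f g c s b hm0 hf P h e L0 L1 L2 hae' hEuler H h0q hfq r hr
    hc hs hid hW
  rw [locHom_apply] at hE
  have hm1 : m - 1 + 1 = m := by omega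
  refine ⟨⟨E, by rw [hm1]; exact hE⟩, ?_⟩
  exact MvPowerSeries.milnor_of_equiv _ (m - 1) E (by rw [hm1]; exact hE)
end
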